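/- arXiv:1603.01512 — 2 statements merged into one kernel-verified Lean document; each statement's English description precedes it below -/
import Mathlib

section
/- There is a universal constant C such that for every m ≥ 1 and every choice of real weights w₁,…,w_m, there exists a C·m²-uniform random permutation σ of {1,…,m} that is 7-balanced with probability 1. Moreover, if |Σ_{i=1}^m w_i| > 15·max_{i≤m} |w_i|, then there exists a C·m²-uniform random permutation that is 0-balanced with probability 1. -/
open Finset

/-- A random permutation of `{1,…,m}`: a probability distribution on `S_m`. -/
def IsRandomPerm {m : ℕ} (μ : Equiv.Perm (Fin m) → ℝ) : Prop :=
  (∀ σ, 0 ≤ μ σ) ∧ ∑ σ : Equiv.Perm (Fin m), μ σ = 1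

/-- `μ` is `α`-uniform: for every `1 ≤ k ≤ m` and every `k`-subset `U`,
`Pr[σ({1,…,k}) = U] ≤ α (m choose k)⁻¹`. -/
def IsAlphaUniform {m : ℕ} (α : ℝ) (μ : Equiv.Perm (Fin m) → ℝ) : Prop :=
  ∀ k : ℕ, 1 ≤ k → k ≤ m → ∀ U : Finset (Fin m), U.card = k →
    ∑ σ ∈ Finset.univ.filter (fun σ : Equiv.Perm (Fin m) =>
        (Finset.univ.filter (fun i : Fin m => (i : ℕ) < k)).image σ = U), μ σ ≤
      α * ((m.choose k : ℝ))⁻¹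

/-- `M = max_i |w_i|`. -/
noncomputable def maxAbsWeight {m : ℕ} (w : Fin m → ℝ) : ℝ := sSup {r | ∃ i, r = |w i|}

/-- `σ` is `ℓ`-balanced: every prefix sum of the weights in the order `σ` lies in
`[min{W,0} - ℓM, max{W,0} + ℓM]`. -/
noncomputable def IsBalanced {m : ℕ} (w : Fin m → ℝ) (ℓ : ℕ) (σ : Equiv.Perm (Fin m)) : Prop :=
  ∀ k : ℕ, 1 ≤ k → k ≤ m →
    min (∑ i, w i) 0 - (ℓ : ℝ) * maxAbsWeight w ≤
        ∑ i ∈ Finset.univ.filter (fun i : Fin m => (i : ℕ) < k), w (σ i) ∧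
      ∑ i ∈ Finset.univ.filter (fun i : Fin m => (i : ℕ) < k), w (σ i) ≤
        max (∑ i, w i) 0 + (ℓ : ℝ) * maxAbsWeight w

section Orderings
variable {ι : Type*} [DecidableEq ι]

/-- All orderings of a finite set, as lists. -/
def orderings (s : Finset ι) : Finset (List ι) := ⟨s.val.lists, Multiset.lists_nodup_finset s⟩

omit [DecidableEq ι] in
theorem mem_orderings_iff_coe {s : Finset ι} {l : List ι} : l ∈ orderings s ↔ s.val = l := by
  change l ∈ s.val.lists ↔ _
  rw [Multiset.mem_lists_iff]
  rfl

theorem mem_orderings {s : Finset ι} {l : List ι} :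
    l ∈ orderings s ↔ l.Nodup ∧ l.toFinset = s := by
  rw [mem_orderings_iff_coe]
  constructor
  · intro h
    have hn : l.Nodup := by
      have := s.nodup
      rw [h] at this
      exact Multiset.coe_nodup.1 this
    refine ⟨hn, ?_⟩
    ext a
    rw [List.mem_toFinset, ← Finset.mem_val, h, Multiset.mem_coe]
  · rintro ⟨h1, h2⟩
    rw [← h2, List.toFinset_val, h1.dedup]

theorem length_of_mem_orderings {s : Finset ι} {l : List ι} (h : l ∈ orderings s) :
    l.length = #s := by
  obtain ⟨h1, h2⟩ := mem_orderings.1 h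
  rw [← h2, List.toFinset_card_of_nodup h1]

theorem mem_iff_of_mem_orderings {s : Finset ι} {l : List ι} (h : l ∈ orderings s) {a : ι} :
    a ∈ l ↔ a ∈ s := by
  rw [← (mem_orderings.1 h).2, List.mem_toFinset]

theorem mem_orderings_of_perm {s : Finset ι} {l l' : List ι} (h : l ∈ orderings s)
    (hp : l'.Perm l) : l' ∈ orderings s := by
  obtain ⟨h1, h2⟩ := mem_orderings.1 h
  exact mem_orderings.2 ⟨hp.nodup_iff.2 h1, by rw [← h2, List.toFinset_eq_of_perm _ _ hp]⟩

omit [DecidableEq ι] in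
theorem perm_of_mem_orderings {s : Finset ι} {l l' : List ι} (h : l ∈ orderings s)
    (h' : l' ∈ orderings s) : l.Perm l' := by
  rw [mem_orderings_iff_coe] at h h'
  exact Multiset.coe_eq_coe.1 (h ▸ h')

theorem mem_orderings_self {l : List ι} (h : l.Nodup) : l ∈ orderings l.toFinset :=
  mem_orderings.2 ⟨h, rfl⟩

omit [DecidableEq ι] in
theorem sum_map_of_mem_orderings {s : Finset ι} {f : ι → ℝ} {l : List ι} (h : l ∈ orderings s) :
    (l.map f).sum = ∑ i ∈ s, f i := by
  rw [mem_orderings_iff_coe] at h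
  rw [Finset.sum, h]
  simp

theorem orderings_empty : orderings (∅ : Finset ι) = {[]} := by
  ext l
  rw [mem_orderings, Finset.mem_singleton]
  constructor
  · rintro ⟨-, h⟩
    exact List.toFinset_eq_empty_iff l |>.1 h
  · rintro rfl
    simp

theorem cons_mem_orderings {s : Finset ι} {i : ι} {l : List ι} :
    i :: l ∈ orderings s ↔ i ∈ s ∧ l ∈ orderings (s.erase i) := by
  simp only [mem_orderings, List.nodup_cons, List.toFinset_cons]
  constructor
  · rintro ⟨⟨h1, h2⟩, rfl⟩
    refine ⟨Finset.mem_insert_self _ _, h2, ?_⟩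
    rw [Finset.erase_insert]
    simpa using h1
  · rintro ⟨h1, h2, h3⟩
    refine ⟨⟨?_, h2⟩, ?_⟩
    · rw [← List.mem_toFinset, h3]
      exact Finset.notMem_erase i s
    · rw [h3, Finset.insert_erase h1]

theorem append_mem_orderings {s t : Finset ι} {x y : List ι} (hx : x ∈ orderings s)
    (hy : y ∈ orderings t) (hd : Disjoint s t) : x ++ y ∈ orderings (s ∪ t) := by
  rw [mem_orderings] at *
  refine ⟨?_, ?_⟩
  · refine List.nodup_append.2 ⟨hx.1, hy.1, ?_⟩
    rintro a ha b hb rfl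
    exact Finset.disjoint_left.1 hd (hx.2 ▸ List.mem_toFinset.2 ha) (hy.2 ▸ List.mem_toFinset.2 hb)
  · rw [List.toFinset_append, hx.2, hy.2]

theorem sum_orderings {s : Finset ι} (hs : s.Nonempty) {R : Type*} [AddCommMonoid R]
    (f : List ι → R) :
    ∑ l ∈ orderings s, f l = ∑ i ∈ s, ∑ l ∈ orderings (s.erase i), f (i :: l) := by
  rw [Finset.sum_sigma']
  symm
  refine Finset.sum_bij (fun x _ => x.1 :: x.2) ?_ ?_ ?_ ?_
  · rintro ⟨i, l⟩ h
    rw [Finset.mem_sigma] at h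
    exact cons_mem_orderings.2 h
  · rintro ⟨i, l⟩ _ ⟨j, l'⟩ _ h
    simp only [List.cons.injEq] at h
    obtain ⟨rfl, rfl⟩ := h
    rfl
  · intro l hl
    cases l with
    | nil =>
      have := (mem_orderings.1 hl).2
      simp at this
      exact absurd this.symm hs.ne_empty
    | cons i l => exact ⟨⟨i, l⟩, Finset.mem_sigma.2 (cons_mem_orderings.1 hl), rfl⟩
  · intros
    rfl

theorem card_orderings (s : Finset ι) : #(orderings s) = (#s).factorial := by
  induction h : #s generalizing s with
  | zero =>
    rw [Finset.card_eq_zero] at h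
    subst h
    simp [orderings_empty]
  | succ n ih =>
    have hs : s.Nonempty := Finset.card_pos.1 (by omega)
    rw [Finset.card_eq_sum_ones, sum_orderings hs]
    have : ∀ i ∈ s, ∑ l ∈ orderings (s.erase i), 1 = n.factorial := by
      intro i hi
      rw [← Finset.card_eq_sum_ones]
      exact ih _ (by rw [Finset.card_erase_of_mem hi, h]; rfl)
    rw [Finset.sum_congr rfl this, Finset.sum_const, h, Nat.factorial_succ, smul_eq_mul]

theorem toFinset_take_subset {s : Finset ι} {l : List ι} (h : l ∈ orderings s) (k : ℕ) :
    (l.take k).toFinset ⊆ s := by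
  intro a ha
  rw [List.mem_toFinset] at ha
  exact (mem_iff_of_mem_orderings h).1 (List.mem_of_mem_take ha)

theorem take_drop_mem_orderings {s U : Finset ι} {l : List ι} {k : ℕ} (hl : l ∈ orderings s)
    (hU : (l.take k).toFinset = U) :
    l.take k ∈ orderings U ∧ l.drop k ∈ orderings (s \ U) := by
  obtain ⟨h1, h2⟩ := mem_orderings.1 hl
  refine ⟨mem_orderings.2 ⟨h1.sublist (List.take_sublist _ _), hU⟩,
    mem_orderings.2 ⟨h1.sublist (List.drop_sublist _ _), ?_⟩⟩
  rw [← List.take_append_drop k l, List.nodup_append] at h1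
  rw [← h2, ← List.take_append_drop k l, List.toFinset_append, List.take_append_drop, hU,
    Finset.union_sdiff_cancel_left]
  rw [← hU, Finset.disjoint_left]
  intro a ha hb
  exact h1.2.2 a (List.mem_toFinset.1 ha) a (List.mem_toFinset.1 hb) rfl

theorem card_take_eq_le {s U : Finset ι} {k : ℕ} (hk : k ≤ #s) :
    #{l ∈ orderings s | (l.take k).toFinset = U} ≤ k.factorial * (#s - k).factorial := by
  by_cases hne : ({l ∈ orderings s | (l.take k).toFinset = U}).Nonempty
  · obtain ⟨l₀, hl₀⟩ := hne
    rw [Finset.mem_filter] at hl₀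
    obtain ⟨h1, h2⟩ := take_drop_mem_orderings hl₀.1 hl₀.2
    have hUk : #U = k := by
      rw [← length_of_mem_orderings h1, List.length_take, length_of_mem_orderings hl₀.1]
      omega
    have hsU : #(s \ U) = #s - k := by
      rw [← length_of_mem_orderings h2, List.length_drop, length_of_mem_orderings hl₀.1]
    subst hUk
    rw [← hsU, ← card_orderings, ← card_orderings, ← Finset.card_product]
    refine Finset.card_le_card_of_injOn (fun l => (l.take #U, l.drop #U)) ?_ ?_
    · intro l hl
      rw [Finset.mem_coe, Finset.mem_filter] at hl
      have := take_drop_mem_orderings hl.1 hl.2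
      simpa using this
    · intro l _ l' _ h
      simp only [Prod.mk.injEq] at h
      rw [← List.take_append_drop #U l, h.1, h.2, List.take_append_drop]
  · rw [Finset.not_nonempty_iff_eq_empty] at hne
    rw [hne]
    simp

end Orderings

section Parsing
variable {ι : Type*}

/-- The total weight of a list. -/
def listWeight (w : ι → ℝ) (l : List ι) : ℝ := (l.map w).sum

/-- All prefixes of the list have weight smaller than `K` in absolute value. -/
def IsSmall (w : ι → ℝ) (K : ℝ) (l : List ι) : Prop := ∀ p, p <+: l → |listWeight w p| < K

/-- A block is a list whose weight reaches `K` in absolute value for the first time at its end. -/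
def IsBlock (w : ι → ℝ) (K : ℝ) (B : List ι) : Prop :=
  ∃ B' x, B = B' ++ [x] ∧ IsSmall w K B' ∧ K ≤ |listWeight w B|

/-- `l` is cut into the blocks of `O` followed by the small remainder `ρ`. -/
def IsParse (w : ι → ℝ) (K : ℝ) (l : List ι) (O : List (List ι)) (ρ : List ι) : Prop :=
  l = O.flatten ++ ρ ∧ (∀ B ∈ O, IsBlock w K B) ∧ IsSmall w K ρ

variable {w : ι → ℝ} {K : ℝ}

@[simp] theorem listWeight_nil : listWeight w [] = 0 := by simp [listWeight]

@[simp] theorem listWeight_cons (i : ι) (l : List ι) :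
    listWeight w (i :: l) = w i + listWeight w l := by simp [listWeight]

@[simp] theorem listWeight_append (l l' : List ι) :
    listWeight w (l ++ l') = listWeight w l + listWeight w l' := by simp [listWeight]

@[simp] theorem listWeight_flatten (O : List (List ι)) :
    listWeight w O.flatten = (O.map (listWeight w)).sum := by
  induction O with
  | nil => simp
  | cons B O ih => simp [ih]

theorem listWeight_perm {l l' : List ι} (h : l.Perm l') : listWeight w l = listWeight w l' :=
  (h.map w).sum_eq

@[simp] theorem listWeight_reverse (l : List ι) : listWeight w l.reverse = listWeight w l :=
  listWeight_perm (List.reverse_perm l)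

theorem listWeight_of_mem_orderings {s : Finset ι} {l : List ι} (h : l ∈ orderings s) :
    listWeight w l = ∑ i ∈ s, w i := by
  rw [listWeight, sum_map_of_mem_orderings h]

theorem isSmall_nil (hK : 0 < K) : IsSmall w K [] := by
  intro p hp
  rw [List.prefix_nil] at hp
  subst hp
  simpa using hK

theorem IsSmall.append_singleton {l : List ι} {x : ι} (h : IsSmall w K l)
    (hx : |listWeight w (l ++ [x])| < K) : IsSmall w K (l ++ [x]) := by
  intro p hp
  rcases List.prefix_concat_iff.1 hp with rfl | hp
  · exact hx
  · exact h p hp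

theorem IsBlock.ne_nil {B : List ι} (h : IsBlock w K B) : B ≠ [] := by
  obtain ⟨B', x, rfl, -⟩ := h
  simp

theorem IsBlock.not_prefix {B l : List ι} (h : IsBlock w K B) (hl : IsSmall w K l) : ¬ B <+: l := by
  intro hp
  obtain ⟨B', x, rfl, -, h2⟩ := h
  exact absurd (hl _ hp) (not_lt.2 h2)

theorem IsBlock.abs_lt_of_prefix {B p : List ι} (h : IsBlock w K B) (hp : p <+: B)
    (hne : p ≠ B) : |listWeight w p| < K := by
  obtain ⟨B', x, rfl, h1, -⟩ := h
  rcases List.prefix_concat_iff.1 hp with rfl | hp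
  · exact absurd rfl hne
  · exact h1 _ hp

theorem IsBlock.le_abs {B : List ι} (h : IsBlock w K B) : K ≤ |listWeight w B| := by
  obtain ⟨B', x, rfl, -, h⟩ := h
  exact h

theorem IsBlock.eq_of_prefix {B B' : List ι} (h : IsBlock w K B) (h' : IsBlock w K B')
    (hp : B <+: B') : B = B' := by
  by_contra hne
  exact absurd (h'.abs_lt_of_prefix hp hne) (not_lt.2 h.le_abs)

theorem IsBlock.eq_of_prefix_of_prefix {B B' l : List ι} (h : IsBlock w K B)
    (h' : IsBlock w K B') (hp : B <+: l) (hp' : B' <+: l) : B = B' := by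
  rcases List.prefix_or_prefix_of_prefix hp hp' with h1 | h1
  · exact h.eq_of_prefix h' h1
  · exact (h'.eq_of_prefix h h1).symm

theorem exists_isParse (hK : 0 < K) (l : List ι) : ∃ O ρ, IsParse w K l O ρ := by
  induction l using List.reverseRecOn with
  | nil => exact ⟨[], [], rfl, by simp, isSmall_nil hK⟩
  | append_singleton l x ih =>
    obtain ⟨O, ρ, h1, h2, h3⟩ := ih
    by_cases hx : |listWeight w (ρ ++ [x])| < K
    · exact ⟨O, ρ ++ [x], by simp [h1], h2, h3.append_singleton hx⟩
    · refine ⟨O ++ [ρ ++ [x]], [], by simp [h1], ?_, isSmall_nil hK⟩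
      intro B hB
      rw [List.mem_append, List.mem_singleton] at hB
      rcases hB with hB | rfl
      · exact h2 B hB
      · exact ⟨ρ, x, rfl, h3, not_lt.1 hx⟩

theorem IsParse.unique {l : List ι} {O O' : List (List ι)} {ρ ρ' : List ι}
    (h : IsParse w K l O ρ) (h' : IsParse w K l O' ρ') : O = O' ∧ ρ = ρ' := by
  induction O generalizing l O' with
  | nil =>
    obtain ⟨h1, h2, h3⟩ := h
    obtain ⟨h1', h2', h3'⟩ := h'
    cases O' with
    | nil => simp_all
    | cons B O' =>
      exfalso
      refine (h2' B (by simp)).not_prefix h3 ⟨O'.flatten ++ ρ', ?_⟩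
      simp_all
  | cons B O ih =>
    obtain ⟨h1, h2, h3⟩ := h
    obtain ⟨h1', h2', h3'⟩ := h'
    cases O' with
    | nil =>
      exfalso
      refine (h2 B (by simp)).not_prefix h3' ⟨O.flatten ++ ρ, ?_⟩
      simp_all
    | cons B' O' =>
      have hB : B = B' := by
        refine (h2 B (by simp)).eq_of_prefix_of_prefix (l := l) (h2' B' (by simp))
          ⟨O.flatten ++ ρ, ?_⟩ ⟨O'.flatten ++ ρ', ?_⟩
        · simp [h1]
        · simp [h1']
      subst hB
      have := ih (l := O.flatten ++ ρ) (O' := O')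
        ⟨rfl, fun C hC => h2 C (by simp [hC]), h3⟩
        ⟨?_, fun C hC => h2' C (by simp [hC]), h3'⟩
      · simp [this.1, this.2]
      · rw [h1'] at h1
        simpa using h1.symm

theorem length_le_length_flatten {O : List (List ι)} (h : ∀ B ∈ O, B ≠ []) :
    O.length ≤ O.flatten.length := by
  induction O with
  | nil => simp
  | cons B O ih =>
    have h1 := ih fun C hC => h C (by simp [hC])
    have h2 := List.length_pos_iff.2 (h B (by simp))
    simp only [List.length_cons, List.flatten_cons, List.length_append]
    omega

theorem nodup_of_nodup_flatten {O : List (List ι)} (h : ∀ B ∈ O, B ≠ [])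
    (hn : O.flatten.Nodup) : O.Nodup := by
  rw [List.nodup_flatten] at hn
  refine hn.2.imp_of_mem ?_
  rintro A B hA hB hd rfl
  obtain ⟨a, ha⟩ := List.exists_mem_of_ne_nil A (h A hA)
  exact hd ha ha

variable [DecidableEq ι]

/-- Orderings of `s`, grouped according to their unordered set of blocks and their remainder. -/
theorem exists_configurations (hK : 0 < K) (s : Finset ι) :
    ∃ 𝒞 : Finset (Finset (List ι) × List ι),
      (∀ c ∈ 𝒞, (∀ B ∈ c.1, IsBlock w K B) ∧ IsSmall w K c.2 ∧
        ∀ O ∈ orderings c.1, O.flatten ++ c.2 ∈ orderings s) ∧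
      ∀ f : List ι → ℝ, ∑ l ∈ orderings s, f l =
        ∑ c ∈ 𝒞, ∑ O ∈ orderings c.1, f (O.flatten ++ c.2) := by
  choose blocks rest hp using exists_isParse (w := w) hK
  let F : List ι → Finset (List ι) × List ι := fun l => ((blocks l).toFinset, rest l)
  have hnd : ∀ l ∈ orderings s, (blocks l).Nodup := by
    intro l hl
    refine nodup_of_nodup_flatten (fun B hB => ((hp l).2.1 B hB).ne_nil) ?_
    have := (mem_orderings.1 hl).1
    rw [(hp l).1] at this
    exact this.sublist (List.sublist_append_left _ _)
  have hmem : ∀ l ∈ orderings s, ∀ O ∈ orderings (F l).1, O.flatten ++ rest l ∈ orderings s := by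
    intro l hl O hO
    have h2 := perm_of_mem_orderings hO (mem_orderings_self (hnd l hl))
    refine mem_orderings_of_perm hl ?_
    nth_rw 2 [(hp l).1]
    exact h2.flatten.append_right _
  have hblk : ∀ l ∈ orderings s, ∀ O ∈ orderings (F l).1,
      IsParse w K (O.flatten ++ rest l) O (rest l) := by
    intro l hl O hO
    refine ⟨rfl, fun B hB => (hp l).2.1 B ?_, (hp l).2.2⟩
    exact List.mem_toFinset.1 ((mem_iff_of_mem_orderings hO).1 hB)
  refine ⟨(orderings s).image F, ?_, ?_⟩
  · intro c hc
    obtain ⟨l, hl, rfl⟩ := Finset.mem_image.1 hc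
    refine ⟨?_, (hp l).2.2, hmem l hl⟩
    intro B hB
    exact (hp l).2.1 B (List.mem_toFinset.1 hB)
  · intro f
    rw [← Finset.sum_fiberwise_of_maps_to (g := F) (t := (orderings s).image F)
      (fun l hl => Finset.mem_image_of_mem F hl)]
    refine Finset.sum_congr rfl ?_
    intro c hc
    obtain ⟨l, hl, rfl⟩ := Finset.mem_image.1 hc
    symm
    refine Finset.sum_bij (fun O _ => O.flatten ++ rest l) ?_ ?_ ?_ ?_
    · intro O hO
      obtain ⟨h1, h2⟩ := (hblk l hl O hO).unique (hp _)
      refine Finset.mem_filter.2 ⟨hmem l hl O hO, ?_⟩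
      change (_, _) = (_, _)
      rw [← h1, ← h2, (mem_orderings.1 hO).2]
    · intro O hO O' hO' h
      have h1 := hblk l hl O hO
      rw [h] at h1
      exact (h1.unique (hblk l hl O' hO')).1
    · intro l' hl'
      obtain ⟨hl', h⟩ := Finset.mem_filter.1 hl'
      have h' : (blocks l').toFinset = (F l).1 ∧ rest l' = rest l := by
        simpa [F, Prod.ext_iff] using h
      refine ⟨blocks l', ?_, ?_⟩
      · rw [← h'.1]
        exact mem_orderings_self (hnd l' hl')
      · rw [← h'.2]
        exact (hp l').1.symm
    · intros
      rfl

end Parsing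

section Concentration
open MeasureTheory ProbabilityTheory

theorem sum_exp_sub_mean_le {α : Type*} {S : Finset α} (hS : S.Nonempty) {f : α → ℝ} {A c : ℝ}
    (hf : ∀ i ∈ S, f i ∈ Set.Icc A (A + c)) (θ : ℝ) :
    ∑ i ∈ S, Real.exp (θ * (f i - (∑ j ∈ S, f j) / #S)) ≤
      #S * Real.exp (θ ^ 2 * c ^ 2 / 8) := by
  have hN : (0 : ℝ) < #S := by exact_mod_cast hS.card_pos
  let μ : Measure ℝ := ENNReal.ofReal ((#S : ℝ)⁻¹) • ∑ i ∈ S, Measure.dirac (f i)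
  have hint : ∀ g : ℝ → ℝ, ∫ x, g x ∂μ = (∑ i ∈ S, g (f i)) / #S := by
    intro g
    simp only [μ]
    rw [integral_smul_measure, integral_finsetSum_measure]
    · simp only [integral_dirac]
      rw [ENNReal.toReal_ofReal (by positivity), smul_eq_mul]
      field_simp
    · intro i _
      exact integrable_dirac (by simp)
  have hprob : IsProbabilityMeasure μ := by
    constructor
    simp only [μ, Measure.smul_apply, Measure.finsetSum_apply, measure_univ, Finset.sum_const,
      smul_eq_mul, nsmul_eq_mul, mul_one]
    rw [ENNReal.ofReal_inv_of_pos hN, ENNReal.ofReal_natCast]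
    exact ENNReal.inv_mul_cancel (by exact_mod_cast hN.ne') (by simp)
  have hb : ∀ᵐ x ∂μ, (fun x : ℝ => x) x ∈ Set.Icc A (A + c) := by
    refine Measure.ae_smul_measure ?_ _
    rw [ae_iff]
    simp only [Measure.finsetSum_apply]
    refine Finset.sum_eq_zero ?_
    intro i hi
    rw [← ae_iff, ae_dirac_eq]
    exact hf i hi
  have h1 := (hasSubgaussianMGF_of_mem_Icc (μ := μ) (X := fun x : ℝ => x)
    measurable_id.aemeasurable hb).mgf_le θ
  rw [mgf, hint, hint fun x => x, div_le_iff₀ hN, mul_comm] at h1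
  refine h1.trans_eq ?_
  congr 2
  simp only [add_sub_cancel_left, NNReal.coe_pow, NNReal.coe_div, coe_nnnorm, NNReal.coe_ofNat,
    Real.norm_eq_abs, div_pow, sq_abs]
  ring

variable {α : Type*} [DecidableEq α]

theorem sum_exp_deviation_le {S : Finset α} {f : α → ℝ} {A c : ℝ}
    (hf : ∀ i ∈ S, f i ∈ Set.Icc A (A + c)) (θ : ℝ) {a : ℕ} (ha : a ≤ #S) :
    ∑ l ∈ orderings S,
        Real.exp (θ * (((l.take a).map f).sum - a * ((∑ j ∈ S, f j) / #S))) ≤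
      (#S).factorial * Real.exp (θ ^ 2 * c ^ 2 * (a * (#S - a) / #S) / 4) := by
  induction a generalizing S with
  | zero => simp [card_orderings]
  | succ a ih =>
    have hS : S.Nonempty := Finset.card_pos.1 (by omega)
    have hN : (0 : ℝ) < #S := by exact_mod_cast hS.card_pos
    rcases ha.eq_or_lt with heq | hlt
    · have : ∀ l ∈ orderings S, Real.exp (θ * (((l.take (a + 1)).map f).sum
          - (a + 1 : ℕ) * ((∑ j ∈ S, f j) / #S))) = 1 := by
        intro l hl
        rw [List.take_of_length_le (by rw [length_of_mem_orderings hl, heq]),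
          sum_map_of_mem_orderings hl, heq, mul_div_cancel₀ _ hN.ne']
        simp
      rw [Finset.sum_congr rfl this, heq]
      simp [card_orderings]
    · rw [sum_orderings hS]
      obtain ⟨n, hn⟩ : ∃ n, #S = n + 2 := ⟨#S - 2, by omega⟩
      set m := (∑ j ∈ S, f j) / #S with hm
      have hsum : ∑ j ∈ S, f j = (n + 2) * m := by
        rw [hm, hn]
        push_cast
        field_simp
      have key : ∀ i ∈ S, ∑ l ∈ orderings (S.erase i),
          Real.exp (θ * ((((i :: l).take (a + 1)).map f).sum - (a + 1 : ℕ) * m)) ≤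
          Real.exp (θ * ((n + 1 - a) / (n + 1)) * (f i - m)) *
          ((n + 1).factorial * Real.exp (θ ^ 2 * c ^ 2 * (a * (n + 1 - a) / (n + 1)) / 4)) := by
        intro i hi
        have hc : #(S.erase i) = n + 1 := by rw [Finset.card_erase_of_mem hi, hn]; rfl
        have h1 := ih (S := S.erase i) (fun j hj => hf j (Finset.mem_of_mem_erase hj))
          (by rw [hc]; omega)
        rw [hc] at h1
        push_cast at h1
        refine le_trans (le_of_eq ?_) (mul_le_mul_of_nonneg_left h1 (Real.exp_nonneg _))
        rw [Finset.mul_sum]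
        refine Finset.sum_congr rfl fun l _ => ?_
        rw [← Real.exp_add, Finset.sum_erase_eq_sub hi, hsum]
        congr 1
        simp only [List.take_succ_cons, List.map_cons, List.sum_cons]
        push_cast
        field_simp
        ring
      refine (Finset.sum_le_sum key).trans ?_
      rw [← Finset.sum_mul]
      have h2 := sum_exp_sub_mean_le hS hf (θ * ((n + 1 - a) / (n + 1)))
      rw [← hm] at h2
      refine (mul_le_mul_of_nonneg_right h2 (by positivity)).trans ?_
      rw [hn, Nat.factorial_succ (n + 1)]
      push_cast
      have han : (a : ℝ) + 1 ≤ n + 2 := by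
        rw [hn] at ha
        exact_mod_cast ha
      have hexp : (θ * ((n + 1 - a) / (n + 1))) ^ 2 * c ^ 2 / 8 +
          θ ^ 2 * c ^ 2 * (a * (n + 1 - a) / (n + 1)) / 4 ≤
          θ ^ 2 * c ^ 2 * ((a + 1) * (n + 2 - (a + 1)) / (n + 2)) / 4 := by
        have h3 : ((n + 1 - a : ℝ) / (n + 1)) ^ 2 / 8 + (a * (n + 1 - a) / (n + 1)) / 4 ≤
            ((a + 1) * (n + 2 - (a + 1)) / (n + 2)) / 4 := by
          rw [← sub_nonneg]
          have : ((a + 1) * (n + 2 - (a + 1)) / (n + 2)) / 4 -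
              (((n + 1 - a : ℝ) / (n + 1)) ^ 2 / 8 + (a * (n + 1 - a) / (n + 1)) / 4) =
              (n * (n + 1 - a) ^ 2) / (8 * (n + 2) * (n + 1) ^ 2) := by
            field_simp
            ring
          rw [this]
          positivity
        have h4 := mul_le_mul_of_nonneg_left h3 (by positivity : 0 ≤ θ ^ 2 * c ^ 2)
        refine le_trans (le_of_eq ?_) (h4.trans (le_of_eq ?_)) <;> ring
      calc _ = (n + 2 : ℝ) * ((n + 1).factorial) *
            Real.exp ((θ * ((n + 1 - a) / (n + 1))) ^ 2 * c ^ 2 / 8 +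
              θ ^ 2 * c ^ 2 * (a * (n + 1 - a) / (n + 1)) / 4) := by
            rw [Real.exp_add]; ring
        _ ≤ (n + 2 : ℝ) * ((n + 1).factorial) *
            Real.exp (θ ^ 2 * c ^ 2 * ((a + 1) * (n + 2 - (a + 1)) / (n + 2)) / 4) := by
            gcongr
        _ = _ := by rw [show (n : ℝ) + 1 + 1 = n + 2 by ring]

/-- Number of orderings with a large deviation after `a` steps. -/
theorem card_deviation_le {S : Finset α} {f : α → ℝ} {A c L : ℝ} (hL : 0 ≤ L) (hc : 0 ≤ c)
    (hf : ∀ i ∈ S, f i ∈ Set.Icc A (A + c)) {a : ℕ} (ha : a ≤ #S) :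
    (#{l ∈ orderings S | L * c ^ 2 * (a * (#S - a) / #S) <
      (((l.take a).map f).sum - a * ((∑ j ∈ S, f j) / #S)) ^ 2} : ℝ) ≤
      2 * Real.exp (-L) * (#S).factorial := by
  set y : ℝ := a * (#S - a) / #S with hy
  set D : List α → ℝ := fun l => ((l.take a).map f).sum - a * ((∑ j ∈ S, f j) / #S) with hD
  have hy0 : 0 ≤ y := by
    have : (a : ℝ) ≤ #S := by exact_mod_cast ha
    have h2 : (0 : ℝ) ≤ #S - a := by linarith
    positivity
  have mgf := fun θ => sum_exp_deviation_le hf θ ha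
  rw [← hy] at mgf
  have one : ∀ θ V : ℝ, θ ^ 2 * c ^ 2 * y / 4 - V ≤ - L → ∀ T ⊆ orderings S,
      (∀ l ∈ T, V ≤ θ * D l) → (#T : ℝ) ≤ Real.exp (-L) * (#S).factorial := by
    intro θ V hV T hT hTV
    have h1 : (#T : ℝ) * Real.exp V ≤ (#S).factorial * Real.exp (θ ^ 2 * c ^ 2 * y / 4) := by
      refine le_trans ?_ (mgf θ)
      refine le_trans ?_ (Finset.sum_le_sum_of_subset_of_nonneg hT
        fun _ _ _ => Real.exp_nonneg _)
      rw [← nsmul_eq_mul, ← Finset.sum_const]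
      exact Finset.sum_le_sum fun l hl => Real.exp_le_exp.2 (hTV l hl)
    have h2 : Real.exp (θ ^ 2 * c ^ 2 * y / 4) ≤ Real.exp (-L) * Real.exp V := by
      rw [← Real.exp_add, Real.exp_le_exp]
      linarith
    have h3 : (#T : ℝ) * Real.exp V ≤ (Real.exp (-L) * (#S).factorial) * Real.exp V := by
      refine h1.trans ?_
      calc _ ≤ ((#S).factorial : ℝ) * (Real.exp (-L) * Real.exp V) := by gcongr
        _ = _ := by ring
    exact le_of_mul_le_mul_right h3 (Real.exp_pos _)
  have split : ∀ V θ : ℝ, θ ^ 2 * c ^ 2 * y / 4 - V ≤ - L → 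
      (∀ l, L * c ^ 2 * y < D l ^ 2 → V ≤ θ * D l ∨ V ≤ (-θ) * D l) →
      (#{l ∈ orderings S | L * c ^ 2 * y < D l ^ 2} : ℝ) ≤ 2 * Real.exp (-L) * (#S).factorial := by
    intro V θ hV h
    have hsub : {l ∈ orderings S | L * c ^ 2 * y < D l ^ 2} ⊆
        {l ∈ orderings S | V ≤ θ * D l} ∪ {l ∈ orderings S | V ≤ (-θ) * D l} := by
      intro l hl
      rw [Finset.mem_filter] at hl
      rw [Finset.mem_union, Finset.mem_filter, Finset.mem_filter]
      rcases h l hl.2 with h | h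
      · exact Or.inl ⟨hl.1, h⟩
      · exact Or.inr ⟨hl.1, h⟩
    have h1 := one θ V hV {l ∈ orderings S | V ≤ θ * D l} (Finset.filter_subset _ _)
      (fun l hl => (Finset.mem_filter.1 hl).2)
    have h2 := one (-θ) V (by simpa using hV) {l ∈ orderings S | V ≤ (-θ) * D l}
      (Finset.filter_subset _ _) (fun l hl => (Finset.mem_filter.1 hl).2)
    have h3 : (#{l ∈ orderings S | L * c ^ 2 * y < D l ^ 2} : ℝ) ≤
        #{l ∈ orderings S | V ≤ θ * D l} + #{l ∈ orderings S | V ≤ (-θ) * D l} := by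
      exact_mod_cast (Finset.card_le_card hsub).trans (Finset.card_union_le _ _)
    linarith
  rcases eq_or_lt_of_le (mul_nonneg (sq_nonneg c) hy0) with h0 | hpos
  · have hzero : ∀ l ∈ orderings S, D l = 0 := by
      intro l hl
      have hb : ∀ θ : ℝ, θ * D l ≤ Real.log ((#S).factorial) := by
        intro θ
        have h1 := (Finset.single_le_sum (f := fun l => Real.exp (θ * D l))
          (fun _ _ => Real.exp_nonneg _) hl).trans (mgf θ)
        rw [mul_assoc (θ ^ 2), ← h0] at h1
        simp only [mul_zero, zero_div, Real.exp_zero, mul_one] at h1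
        exact (Real.le_log_iff_exp_le (by exact_mod_cast Nat.factorial_pos _)).2 h1
      by_contra hne
      have := hb ((Real.log ((#S).factorial) + 1) / D l)
      rw [div_mul_cancel₀ _ hne] at this
      linarith
    have : {l ∈ orderings S | L * c ^ 2 * y < D l ^ 2} = ∅ := by
      rw [Finset.filter_eq_empty_iff]
      intro l hl
      rw [hzero l hl, mul_assoc, ← h0]
      simp
    rw [this]
    simp only [Finset.card_empty, Nat.cast_zero]
    positivity
  · refine split (2 * L) (2 * Real.sqrt (L / (c ^ 2 * y))) ?_ ?_
    · rw [mul_pow, Real.sq_sqrt (by positivity)]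
      have : 2 ^ 2 * (L / (c ^ 2 * y)) * c ^ 2 * y / 4 = L := by
        have h1 : c ≠ 0 := by rintro rfl; simp at hpos
        have h2 : y ≠ 0 := by rintro h; simp [h] at hpos
        field_simp
        ring
      linarith
    · intro l hl
      have habs : L ≤ Real.sqrt (L / (c ^ 2 * y)) * |D l| := by
        rw [← Real.sqrt_sq_eq_abs, ← Real.sqrt_mul (by positivity)]
        refine Real.le_sqrt_of_sq_le ?_
        rw [div_mul_eq_mul_div, le_div_iff₀ hpos]
        nlinarith
      rcases abs_cases (D l) with ⟨h, -⟩ | ⟨h, -⟩ <;> rw [h] at habs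
      · left; linarith
      · right; linarith

end Concentration

section Arithmetic
open Real

theorem factorial_le_stirling (a : ℕ) :
    (a.factorial : ℝ) ≤ exp 1 * √(a + 1) * (a / exp 1) ^ a := by
  cases a with
  | zero => simp
  | succ k =>
    have h := Stirling.stirlingSeq'_antitone (Nat.zero_le k)
    simp only [Function.comp, Nat.succ_eq_add_one, zero_add, Stirling.stirlingSeq_one] at h
    rw [Stirling.stirlingSeq, div_le_iff₀ (by positivity)] at h
    refine h.trans ?_
    rw [← mul_assoc, Real.sqrt_mul zero_le_two]
    have h2 : (0 : ℝ) < √2 := by positivity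
    have h3 : exp 1 / √2 * (√2 * √((k + 1 : ℕ) : ℝ)) = exp 1 * √((k + 1 : ℕ) : ℝ) := by
      field_simp
    rw [h3]
    gcongr
    linarith

theorem factorial_mul_factorial_le {a b : ℕ} (h : 1 ≤ a + b) :
    (a.factorial * b.factorial : ℝ) ≤
      5 * √(a + b) * (a / (a + b)) ^ a * (b / (a + b)) ^ b * (a + b).factorial := by
  have ha := factorial_le_stirling a
  have hb := factorial_le_stirling b
  have hn := Stirling.le_factorial_stirling (a + b)
  have h1 : (1 : ℝ) ≤ a + b := by exact_mod_cast h
  set n : ℝ := a + b with hndef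
  have hn0 : 0 < n := by linarith
  have hcast : ((a + b : ℕ) : ℝ) = n := by push_cast; rfl
  rw [hcast] at hn
  have hsq : √(a + 1) * √(b + 1) ≤ 3 / 2 * n := by
    rw [← Real.sqrt_mul (by positivity)]
    refine Real.sqrt_le_iff.2 ⟨by positivity, ?_⟩
    nlinarith [sq_nonneg ((a : ℝ) - b)]
  have he : exp 1 * exp 1 * (3 / 2) ≤ 5 * √(2 * π) := by
    have h2 : (5 / 2 : ℝ) ≤ √(2 * π) := by
      refine Real.le_sqrt_of_sq_le ?_
      nlinarith [Real.pi_gt_d2]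
    have h3 := Real.exp_one_lt_d9
    nlinarith [Real.exp_pos 1]
  have hs : √n * √n = n := Real.mul_self_sqrt hn0.le
  calc (a.factorial * b.factorial : ℝ)
      ≤ (exp 1 * √(a + 1) * (a / exp 1) ^ a) * (exp 1 * √(b + 1) * (b / exp 1) ^ b) := by
        gcongr
    _ = (exp 1 * exp 1) * (√(a + 1) * √(b + 1)) * ((a / exp 1) ^ a * (b / exp 1) ^ b) := by ring
    _ ≤ (exp 1 * exp 1) * (3 / 2 * n) * ((a / exp 1) ^ a * (b / exp 1) ^ b) := by gcongr
    _ = (exp 1 * exp 1 * (3 / 2)) * (√n * √n) * ((a / exp 1) ^ a * (b / exp 1) ^ b) := by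
        rw [hs]; ring
    _ ≤ (5 * √(2 * π)) * (√n * √n) * ((a / exp 1) ^ a * (b / exp 1) ^ b) := by gcongr
    _ = 5 * √n * (a / n) ^ a * (b / n) ^ b * (√(2 * π * n) * (n / exp 1) ^ (a + b)) := by
        rw [Real.sqrt_mul (by positivity : 0 ≤ 2 * π) n, pow_add]
        have e1 : (a / exp 1 : ℝ) ^ a = (a / n) ^ a * (n / exp 1) ^ a := by
          rw [← mul_pow]
          congr 1
          field_simp
        have e2 : (b / exp 1 : ℝ) ^ b = (b / n) ^ b * (n / exp 1) ^ b := by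
          rw [← mul_pow]
          congr 1
          field_simp
        rw [e1, e2]
        ring
    _ ≤ _ := by gcongr

theorem choose_mul_pow_le_one {p q : ℕ} {x y : ℝ} (hx : 0 ≤ x) (hy : 0 ≤ y) (h : x + y = 1) :
    ((p + q).choose p : ℝ) * (x ^ p * y ^ q) ≤ 1 := by
  have h1 := add_pow x y (p + q)
  rw [h, one_pow] at h1
  rw [h1]
  have h2 := Finset.single_le_sum
    (f := fun m => x ^ m * y ^ (p + q - m) * ((p + q).choose m : ℝ)) (s := range (p + q + 1))
    (fun i _ => by positivity) (Finset.mem_range.2 (by omega : p < p + q + 1))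
  refine le_trans (le_of_eq ?_) h2
  simp only [Nat.add_sub_cancel_left]
  ring

theorem div_pow_le_mul_exp {a n : ℕ} {τ : ℝ} (hτ : 0 < τ) :
    ((a : ℝ) / n) ^ a ≤ τ ^ a * exp (a * (a / (n * τ) - 1)) := by
  rw [Real.exp_nat_mul, ← mul_pow]
  refine pow_le_pow_left₀ (by positivity) ?_ _
  have h1 := Real.add_one_le_exp ((a : ℝ) / (n * τ) - 1)
  calc (a : ℝ) / n = τ * (a / (n * τ) - 1 + 1) := by
        field_simp
        ring
    _ ≤ _ := by gcongr

/-- A quantitative chi-square bound for the split of `a + b` elements into two classes. -/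
theorem factorial_mul_factorial_le_exp {a b : ℕ} (h : 1 ≤ a + b) {p q : ℝ} (hp : 0 < p)
    (hq : 0 < q) :
    (a.factorial * b.factorial : ℝ) ≤
      5 * √(a + b) * ((q / (p + q)) ^ a * (p / (p + q)) ^ b) *
        exp ((a * p - b * q) ^ 2 / ((a + b) * (p * q))) * (a + b).factorial := by
  refine (factorial_mul_factorial_le h).trans ?_
  have h1 := div_pow_le_mul_exp (a := a) (n := a + b) (τ := q / (p + q)) (by positivity)
  have h2 := div_pow_le_mul_exp (a := b) (n := a + b) (τ := p / (p + q)) (by positivity)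
  push_cast at h1 h2
  have h0 : (1 : ℝ) ≤ a + b := by exact_mod_cast h
  calc _ ≤ 5 * √(a + b) * ((q / (p + q)) ^ a * exp (a * (a / ((a + b) * (q / (p + q))) - 1))) *
        ((p / (p + q)) ^ b * exp (b * (b / ((a + b) * (p / (p + q))) - 1))) *
          (a + b).factorial := by gcongr
    _ = 5 * √(a + b) * ((q / (p + q)) ^ a * (p / (p + q)) ^ b) *
        (exp (a * (a / ((a + b) * (q / (p + q))) - 1)) *
          exp (b * (b / ((a + b) * (p / (p + q))) - 1))) * (a + b).factorial := by ring
    _ = _ := by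
        rw [← Real.exp_add]
        congr 3
        field_simp
        ring

theorem add_sq_le_of_sq_le {d₁ d₂ c₁ c₂ y₁ y₂ L : ℝ} (hL : 0 ≤ L) (hc₁ : 0 ≤ c₁) (hc₂ : 0 ≤ c₂)
    (hc : c₁ + c₂ = 2) (hy₁ : 0 ≤ y₁) (hy₂ : 0 ≤ y₂) (h₁ : d₁ ^ 2 ≤ L * c₁ ^ 2 * y₁)
    (h₂ : d₂ ^ 2 ≤ L * c₂ ^ 2 * y₂) : (|d₁| + |d₂|) ^ 2 ≤ 4 * L * (y₁ + y₂) := by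
  have e₁ : |d₁| ≤ c₁ * √(L * y₁) := by
    refine (Real.abs_le_sqrt h₁).trans_eq ?_
    rw [mul_right_comm, Real.sqrt_mul (by positivity), Real.sqrt_sq hc₁, mul_comm]
  have e₂ : |d₂| ≤ c₂ * √(L * y₂) := by
    refine (Real.abs_le_sqrt h₂).trans_eq ?_
    rw [mul_right_comm, Real.sqrt_mul (by positivity), Real.sqrt_sq hc₂, mul_comm]
  have m₁ : √(L * y₁) ≤ √(L * (y₁ + y₂)) := Real.sqrt_le_sqrt (by nlinarith)
  have m₂ : √(L * y₂) ≤ √(L * (y₁ + y₂)) := Real.sqrt_le_sqrt (by nlinarith)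
  have h3 : |d₁| + |d₂| ≤ 2 * √(L * (y₁ + y₂)) := by
    calc |d₁| + |d₂| ≤ c₁ * √(L * (y₁ + y₂)) + c₂ * √(L * (y₁ + y₂)) := by
          exact add_le_add (e₁.trans (by gcongr)) (e₂.trans (by gcongr))
      _ = _ := by rw [← add_mul, hc]
  calc (|d₁| + |d₂|) ^ 2 ≤ (2 * √(L * (y₁ + y₂))) ^ 2 := by gcongr
    _ = _ := by
      rw [mul_pow, Real.sq_sqrt (by positivity)]
      ring

theorem mul_div_add_le {a a' b b' : ℝ} (h₁ : 0 < a + a') (h₂ : 0 < b + b') :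
    a * a' / (a + a') + b * b' / (b + b') ≤ (a + b) * (a' + b') / (a + a' + (b + b')) := by
  rw [div_add_div _ _ h₁.ne' h₂.ne', div_le_div_iff₀ (by positivity) (by positivity),
    ← sub_nonneg]
  have : (a + b) * (a' + b') * ((a + a') * (b + b')) -
      (a * a' * (b + b') + (a + a') * (b * b')) * (a + a' + (b + b')) =
      (a * b' - a' * b) ^ 2 := by ring
  rw [this]
  positivity

set_option maxHeartbeats 1000000 in
theorem choose_mul_factorial_le {a a' b b' : ℕ} (h₁ : 1 ≤ a + a') (h₂ : 1 ≤ b + b')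
    {p q d₁ d₂ c₁ c₂ : ℝ} (hp : 5 / 2 ≤ p) (hq : 5 / 2 ≤ q) (hc₁ : 0 ≤ c₁) (hc₂ : 0 ≤ c₂)
    (hc : c₁ + c₂ = 2)
    (hd₁ : d₁ ^ 2 ≤ log (4 * (a + a' + (b + b'))) * c₁ ^ 2 * (a * a' / (a + a')))
    (hd₂ : d₂ ^ 2 ≤ log (4 * (a + a' + (b + b'))) * c₂ ^ 2 * (b * b' / (b + b')))
    (hx : |a * p + d₁ - b * q + d₂| ≤ 9 / 2)
    (hr : |(a + a') * p - (b + b') * q| ≤ 5 / 2) :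
    ((a + a' + (b + b')).choose (a + a') : ℝ) *
      (a.factorial * b.factorial * (a'.factorial * b'.factorial)) ≤
      100 * exp 48 * ((a + a' + (b + b')) ^ 2 + 1) *
        ((a + b).factorial * (a' + b').factorial) := by
  have hfac : ((a + a' + (b + b')).choose (a + a') : ℝ) *
      ((a + a').factorial * (b + b').factorial) = (a + a' + (b + b')).factorial := by
    have := Nat.choose_mul_factorial_mul_factorial (Nat.le_add_right (a + a') (b + b'))
    rw [Nat.add_sub_cancel_left] at this
    rw [← mul_assoc]
    exact_mod_cast this
  have hC : (1 : ℝ) ≤ 100 * exp 48 * ((a + a' + (b + b')) ^ 2 + 1) := by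
    have h3 : (1 : ℝ) ≤ exp 48 := Real.one_le_exp (by norm_num)
    have h4 : (0 : ℝ) ≤ ((a + a' + (b + b')) : ℝ) ^ 2 := by positivity
    nlinarith
  have sevens : ∀ x : ℝ, (x + 7) ^ 2 ≤ 3 / 2 * x ^ 2 + 147 := fun x => by
    nlinarith [sq_nonneg (x - 14)]
  have mul_le : ∀ x y : ℝ, 0 ≤ x → 0 ≤ y → x * y ≤ (x + y) ^ 2 := fun x y hx hy => by
    nlinarith [mul_nonneg hx hy]
  rcases Nat.eq_zero_or_pos (a + b) with h0 | hn
  · obtain ⟨rfl, rfl⟩ : a = 0 ∧ b = 0 := by omega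
    simp only [zero_add, Nat.factorial_zero, Nat.cast_one, one_mul, Nat.cast_zero] at hfac hC ⊢
    rw [hfac]
    exact le_mul_of_one_le_left (by positivity) hC
  rcases Nat.eq_zero_or_pos (a' + b') with h0 | hn'
  · obtain ⟨rfl, rfl⟩ : a' = 0 ∧ b' = 0 := by omega
    simp only [add_zero, Nat.factorial_zero, Nat.cast_one, mul_one, Nat.cast_zero] at hfac hC ⊢
    rw [hfac]
    exact le_mul_of_one_le_left (by positivity) hC
  have hp0 : 0 < p := by linarith
  have hq0 : 0 < q := by linarith
  have hA : (0 : ℝ) ≤ a := by positivity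
  have hA' : (0 : ℝ) ≤ a' := by positivity
  have hB : (0 : ℝ) ≤ b := by positivity
  have hB' : (0 : ℝ) ≤ b' := by positivity
  have r1 : (1 : ℝ) ≤ a + a' := by exact_mod_cast h₁
  have r2 : (1 : ℝ) ≤ b + b' := by exact_mod_cast h₂
  have r3 : (1 : ℝ) ≤ a + b := by exact_mod_cast hn
  have r4 : (1 : ℝ) ≤ a' + b' := by exact_mod_cast hn'
  set t : ℝ := a + a' + (b + b') with ht
  set n : ℝ := a + b with hndef
  set n' : ℝ := a' + b' with hndef'
  have htn : t = n + n' := by rw [ht, hndef, hndef']; ring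
  set L : ℝ := log (4 * t) with hLdef
  have hL : 0 ≤ L := Real.log_nonneg (by linarith)
  have hexpL : exp L = 4 * t := Real.exp_log (by linarith)
  have hΔ := add_sq_le_of_sq_le hL hc₁ hc₂ hc (by positivity) (by positivity) hd₁ hd₂
  have hy := mul_div_add_le (show 0 < (a : ℝ) + a' by linarith) (show 0 < (b : ℝ) + b' by linarith)
  rw [← ht, ← hndef, ← hndef'] at hy
  set Δ : ℝ := |d₁| + |d₂| with hΔdef
  have hΔ0 : 0 ≤ Δ := by positivity
  have hΔ2 : Δ ^ 2 ≤ 4 * L * (n * n' / t) := hΔ.trans (by gcongr)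
  have he : |a * p - b * q| ≤ Δ + 7 := by
    have := abs_le.1 hx
    rw [abs_le]
    constructor <;> linarith [neg_abs_le d₁, le_abs_self d₁, neg_abs_le d₂, le_abs_self d₂]
  have he' : |a' * p - b' * q| ≤ Δ + 7 := by
    have := abs_le.1 hx
    have h6 := abs_le.1 hr
    rw [abs_le]
    constructor <;> linarith [neg_abs_le d₁, le_abs_self d₁, neg_abs_le d₂, le_abs_self d₂]
  have hexp : (a * p - b * q) ^ 2 / (n * (p * q)) + (a' * p - b' * q) ^ 2 / (n' * (p * q)) ≤
      L + 48 := by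
    have q1 : (a * p - b * q) ^ 2 ≤ (Δ + 7) ^ 2 := sq_le_sq.2 (he.trans (le_abs_self _))
    have q2 : (a' * p - b' * q) ^ 2 ≤ (Δ + 7) ^ 2 := sq_le_sq.2 (he'.trans (le_abs_self _))
    have hpq : (25 / 4 : ℝ) ≤ p * q := by
      calc (25 / 4 : ℝ) = 5 / 2 * (5 / 2) := by norm_num
        _ ≤ p * q := by gcongr
    have q3 := sevens Δ
    calc _ ≤ (Δ + 7) ^ 2 / (n * (25 / 4)) + (Δ + 7) ^ 2 / (n' * (25 / 4)) := by gcongr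
      _ = (Δ + 7) ^ 2 * (t / (n * n')) * (4 / 25) := by
          rw [htn]
          field_simp
          ring
      _ ≤ (3 / 2 * (4 * L * (n * n' / t)) + 147) * (t / (n * n')) * (4 / 25) := by
          gcongr
          linarith
      _ = 24 / 25 * L + 147 * (4 / 25) * (1 / n + 1 / n') := by
          rw [htn]
          field_simp
          ring
      _ ≤ L + 48 := by
          have q4 : 1 / n ≤ 1 := (div_le_one (by linarith)).2 r3
          have q5 : 1 / n' ≤ 1 := (div_le_one (by linarith)).2 r4
          linarith
  have f1 := factorial_mul_factorial_le_exp hn hp0 hq0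
  have f2 := factorial_mul_factorial_le_exp hn' hp0 hq0
  rw [← hndef] at f1
  rw [← hndef'] at f2
  have hch := choose_mul_pow_le_one (p := a + a') (q := b + b') (x := q / (p + q))
    (y := p / (p + q)) (by positivity) (by positivity) (by field_simp; ring)
  have hsq : √n * √n' ≤ t := by
    rw [← Real.sqrt_mul (by linarith)]
    refine Real.sqrt_le_iff.2 ⟨by linarith, ?_⟩
    rw [htn]
    exact mul_le n n' (by linarith) (by linarith)
  set E := (a * p - b * q) ^ 2 / (n * (p * q))
  set E' := (a' * p - b' * q) ^ 2 / (n' * (p * q))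
  set G : ℝ := (a + b).factorial * (a' + b').factorial
  set Ch : ℝ := ((a + a' + (b + b')).choose (a + a') : ℝ)
  calc Ch * (a.factorial * b.factorial * (a'.factorial * b'.factorial))
      ≤ Ch * ((5 * √n * ((q / (p + q)) ^ a * (p / (p + q)) ^ b) * exp E * (a + b).factorial) *
        (5 * √n' * ((q / (p + q)) ^ a' * (p / (p + q)) ^ b') * exp E' * (a' + b').factorial)) := by
        gcongr
    _ = (Ch * ((q / (p + q)) ^ (a + a') * (p / (p + q)) ^ (b + b'))) * (25 * (√n * √n') *
        exp (E + E') * G) := by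
        rw [Real.exp_add]
        simp only [pow_add, G]
        ring
    _ ≤ 1 * (25 * t * exp (L + 48) * G) := by gcongr
    _ = 100 * exp 48 * t ^ 2 * G := by
        rw [Real.exp_add, hexpL]
        ring
    _ ≤ _ := by
        gcongr
        linarith

end Arithmetic

section Merging
variable {α : Type*}

/-- Starting from level `x`, elements of positive value are used only at levels `≤ 0` and
the others only at levels `≥ 0`. -/
def Alternates (v : α → ℝ) : ℝ → List α → Prop
  | _, [] => True
  | x, B :: O => (x ≤ 0 ∧ 0 < v B ∨ 0 ≤ x ∧ ¬ 0 < v B) ∧ Alternates v (x + v B) O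

theorem sum_map_pos_ge {v : α → ℝ} {K : ℝ} (hK : 0 < K) {P : List α} (hP : ∀ B ∈ P, K ≤ v B) :
    0 ≤ (P.map v).sum := by
  refine List.sum_nonneg ?_
  intro x hx
  obtain ⟨B, hB, rfl⟩ := List.mem_map.1 hx
  linarith [hP B hB]

theorem sum_map_neg_le {v : α → ℝ} {K : ℝ} (hK : 0 < K) {N : List α} (hN : ∀ B ∈ N, v B ≤ -K) :
    (N.map v).sum ≤ 0 := by
  induction N with
  | nil => simp
  | cons B N ih =>
    have h1 := ih fun C hC => hN C (by simp [hC])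
    have h2 := hN B (by simp)
    simp only [List.map_cons, List.sum_cons]
    linarith

theorem exists_alternates {v : α → ℝ} {K : ℝ} (hK : 0 < K) {P N : List α}
    (hP : ∀ B ∈ P, K ≤ v B) (hN : ∀ B ∈ N, v B ≤ -K) {x : ℝ}
    (hx : |x + (P.map v).sum + (N.map v).sum| < K) :
    ∃ O : List α, O.filter (fun B => 0 < v B) = P ∧ O.filter (fun B => ¬ 0 < v B) = N ∧
      Alternates v x O := by
  induction h : P.length + N.length generalizing P N x with
  | zero =>
    obtain ⟨rfl, rfl⟩ : P = [] ∧ N = [] := by simpa using h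
    exact ⟨[], by simp, by simp, trivial⟩
  | succ n ih =>
    have stepP : ∀ B P', P = B :: P' → x ≤ 0 → ∃ O : List α,
        O.filter (fun B => 0 < v B) = P ∧ O.filter (fun B => ¬ 0 < v B) = N ∧
        Alternates v x O := by
      rintro B P' rfl hx0
      have hB : 0 < v B := by linarith [hP B (by simp)]
      obtain ⟨O, h1, h2, h3⟩ := ih (P := P') (N := N) (x := x + v B)
        (fun C hC => hP C (by simp [hC])) hN
        (by simpa [add_assoc] using hx) (by simp only [List.length_cons] at h; omega)
      refine ⟨B :: O, ?_, ?_, Or.inl ⟨hx0, hB⟩, h3⟩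
      · rw [List.filter_cons_of_pos (by simpa using hB), h1]
      · rw [List.filter_cons_of_neg (by simpa using hB), h2]
    have stepN : ∀ B N', N = B :: N' → 0 ≤ x → ∃ O : List α,
        O.filter (fun B => 0 < v B) = P ∧ O.filter (fun B => ¬ 0 < v B) = N ∧
        Alternates v x O := by
      rintro B N' rfl hx0
      have hB : v B < 0 := by linarith [hN B (by simp)]
      obtain ⟨O, h1, h2, h3⟩ := ih (P := P) (N := N') (x := x + v B) hP
        (fun C hC => hN C (by simp [hC]))
        (by
          refine lt_of_eq_of_lt ?_ hx
          congr 1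
          simp only [List.map_cons, List.sum_cons]
          ring) (by simp only [List.length_cons] at h; omega)
      refine ⟨B :: O, ?_, ?_, Or.inr ⟨hx0, hB.not_gt⟩, h3⟩
      · rw [List.filter_cons_of_neg (by simpa using hB.le), h1]
      · rw [List.filter_cons_of_pos (by simpa using hB.le), h2]
    rw [abs_lt] at hx
    cases P with
    | nil =>
      cases N with
      | nil => simp at h
      | cons B N' =>
        refine stepN B N' rfl ?_
        have h1 := hN B (by simp)
        have h2 := sum_map_neg_le hK (N := N') fun C hC => hN C (by simp [hC])
        simp only [List.map_nil, List.sum_nil, List.map_cons, List.sum_cons] at hx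
        linarith
    | cons B P' =>
      rcases le_or_gt x 0 with hx0 | hx0
      · exact stepP B P' rfl hx0
      · cases N with
        | nil =>
          exfalso
          have h1 := hP B (by simp)
          have h2 := sum_map_pos_ge hK (P := P') fun C hC => hP C (by simp [hC])
          simp only [List.map_nil, List.sum_nil, List.map_cons, List.sum_cons] at hx
          linarith
        | cons B N' => exact stepN B N' rfl hx0.le

theorem Alternates.level_mem {v : α → ℝ} {lo hi x : ℝ} {O : List α} (h : Alternates v x O)
    (hO : ∀ B ∈ O, v B ∈ Set.Icc lo hi) (hx : x ∈ Set.Icc lo hi) {O₁ : List α} (hp : O₁ <+: O) :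
    x + (O₁.map v).sum ∈ Set.Icc lo hi := by
  induction O₁ generalizing x O with
  | nil => simpa using hx
  | cons B O₁ ih =>
    obtain ⟨O₂, rfl⟩ := hp
    have hB := hO B (by simp)
    rw [List.map_cons, List.sum_cons, ← add_assoc]
    refine ih h.2 (fun C hC => hO C (by simp at hC ⊢; tauto)) ?_ ⟨O₂, rfl⟩
    rw [Set.mem_Icc] at *
    rcases h.1 with ⟨h1, h2⟩ | ⟨h1, h2⟩ <;> constructor <;> linarith

variable [DecidableEq α]

theorem filter_mem_orderings {S : Finset α} {O : List α} (h : O ∈ orderings S) (p : α → Prop)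
    [DecidablePred p] : O.filter p ∈ orderings (S.filter p) := by
  obtain ⟨h1, h2⟩ := mem_orderings.1 h
  refine mem_orderings.2 ⟨h1.filter _, ?_⟩
  rw [List.toFinset_filter, h2]
  simp

theorem mem_orderings_of_filter {S : Finset α} {O : List α} (p : α → Prop) [DecidablePred p]
    (h1 : O.filter p ∈ orderings (S.filter p))
    (h2 : O.filter (fun B => ¬ p B) ∈ orderings (S.filter fun B => ¬ p B)) : O ∈ orderings S := by
  have h := append_mem_orderings h1 h2 (Finset.disjoint_filter_filter_not S S p)
  rw [Finset.filter_union_filter_not_eq] at h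
  refine mem_orderings_of_perm h ?_
  have := List.filter_append_perm (fun B => decide (p B)) O
  refine this.symm.trans (List.Perm.of_eq ?_)
  congr 2
  ext B
  simp

/-- `O` is `O₁`, then possibly the element `β`, then `O₂`, where `β` contains the position `k` in
the concatenation of `O`. -/
def IsCut {ι : Type*} (k : ℕ) (O O₁ : List (List ι)) (β : Option (List ι)) (O₂ : List (List ι)) :
    Prop :=
  O = O₁ ++ β.toList ++ O₂ ∧ O₁.flatten.length ≤ k ∧
    (∀ b, β = some b → k < O₁.flatten.length + b.length) ∧ (β = none → O₂ = [])

theorem exists_isCut {ι : Type*} (k : ℕ) (O : List (List ι)) : ∃ O₁ β O₂, IsCut k O O₁ β O₂ := by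
  induction O generalizing k with
  | nil => exact ⟨[], none, [], by simp [IsCut]⟩
  | cons B O ih =>
    by_cases hB : B.length ≤ k
    · obtain ⟨O₁, β, O₂, h1, h2, h3, h4⟩ := ih (k - B.length)
      refine ⟨B :: O₁, β, O₂, by simp [h1], ?_, ?_, h4⟩
      · simp only [List.flatten_cons, List.length_append]
        omega
      · intro b hb
        have := h3 b hb
        simp only [List.flatten_cons, List.length_append]
        omega
    · exact ⟨[], some B, O, by simp, by simp, by simpa using hB, by simp⟩

theorem IsCut.unique {ι : Type*} {k : ℕ} {O O₁ O₂ O₁' O₂' : List (List ι)}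
    {β β' : Option (List ι)} (h : IsCut k O O₁ β O₂) (h' : IsCut k O O₁' β' O₂') :
    O₁ = O₁' ∧ β = β' ∧ O₂ = O₂' := by
  induction O₁ generalizing k O O₁' with
  | nil =>
    cases O₁' with
    | nil =>
      obtain ⟨h1, h2, h3, h4⟩ := h
      obtain ⟨h1', h2', h3', h4'⟩ := h'
      rw [h1] at h1'
      cases β <;> cases β' <;> simp_all
    | cons B O₁' =>
      exfalso
      obtain ⟨h1, h2, h3, h4⟩ := h
      obtain ⟨h1', h2', h3', h4'⟩ := h'
      rw [h1] at h1'
      cases β with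
      | none => simp_all
      | some b =>
        have := h3 b rfl
        simp only [List.flatten_nil, List.length_nil, zero_add] at this
        simp only [List.flatten_cons, List.length_append] at h2'
        simp at h1'
        rw [h1'.1] at this
        omega
  | cons B O₁ ih =>
    cases O₁' with
    | nil =>
      exfalso
      obtain ⟨h1, h2, h3, h4⟩ := h
      obtain ⟨h1', h2', h3', h4'⟩ := h'
      rw [h1] at h1'
      cases β' with
      | none => simp_all
      | some b =>
        have := h3' b rfl
        simp only [List.flatten_nil, List.length_nil, zero_add] at this
        simp only [List.flatten_cons, List.length_append] at h2
        simp at h1'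
        rw [← h1'.1] at this
        omega
    | cons B' O₁' =>
      obtain ⟨h1, h2, h3, h4⟩ := h
      obtain ⟨h1', h2', h3', h4'⟩ := h'
      simp only [List.flatten_cons, List.length_append] at h2 h3 h2' h3'
      have hBB : B = B' := by
        rw [h1] at h1'
        simp at h1'
        exact h1'.1
      subst hBB
      have := ih (k := k - B.length) (O := O.tail) (O₁' := O₁')
        ⟨by simp [h1], by omega, fun b hb => by have := h3 b hb; omega, h4⟩
        ⟨by simp [h1'], by omega, fun b hb => by have := h3' b hb; omega, h4'⟩
      exact ⟨by rw [this.1], this.2⟩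

theorem IsCut.of_perm {ι : Type*} {k : ℕ} {O O₁ O₂ O₁' O₂' : List (List ι)}
    {β : Option (List ι)} (h : IsCut k O O₁ β O₂) (h₁ : O₁'.Perm O₁) (h₂ : O₂'.Perm O₂) :
    IsCut k (O₁' ++ β.toList ++ O₂') O₁' β O₂' := by
  obtain ⟨-, h2, h3, h4⟩ := h
  have hl : O₁'.flatten.length = O₁.flatten.length := h₁.flatten.length_eq
  refine ⟨rfl, by rwa [hl], by rwa [hl], ?_⟩
  intro hβ
  rw [h4 hβ] at h₂
  exact h₂.eq_nil

theorem IsCut.take_eq {ι : Type*} {k : ℕ} {O O₁ O₂ : List (List ι)} {β : Option (List ι)}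
    (h : IsCut k O O₁ β O₂) (ρ : List ι) :
    (O.flatten ++ ρ).take k = O₁.flatten ++ (β.getD ρ).take (k - O₁.flatten.length) := by
  obtain ⟨h1, h2, h3, h4⟩ := h
  cases β with
  | none =>
    rw [h4 rfl] at h1
    simp only [Option.toList_none, List.append_nil] at h1
    rw [h1, List.take_append, List.take_of_length_le h2]
    rfl
  | some b =>
    have := h3 b rfl
    rw [h1]
    simp only [Option.toList_some, List.flatten_append, List.flatten_cons, List.flatten_nil,
      List.append_nil, List.append_assoc, Option.getD_some]
    rw [List.take_append, List.take_append, List.take_of_length_le h2,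
      Nat.sub_eq_zero_of_le (by omega : k - O₁.flatten.length ≤ b.length), List.take_zero,
      List.append_nil]

theorem IsCut.toFinset_take {ι : Type*} [DecidableEq ι] {k : ℕ}
    {O O₁ O₂ O' O₁' O₂' : List (List ι)}
    {β : Option (List ι)} (h : IsCut k O O₁ β O₂) (h' : IsCut k O' O₁' β O₂')
    (h₁ : O₁.Perm O₁') (ρ : List ι) :
    ((O.flatten ++ ρ).take k).toFinset = ((O'.flatten ++ ρ).take k).toFinset := by
  rw [h.take_eq, h'.take_eq, h₁.flatten.length_eq, List.toFinset_append, List.toFinset_append,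
    List.toFinset_eq_of_perm _ _ h₁.flatten]

end Merging

section Density
variable {α : Type*} [DecidableEq α]

/-- All partial sums of `l` are as close to their mean as expected from a uniformly random
ordering of `S`. -/
def IsTypical (f : α → ℝ) (S : Finset α) (c L : ℝ) (l : List α) : Prop :=
  ∀ a ≤ #S, (((l.take a).map f).sum - a * ((∑ j ∈ S, f j) / #S)) ^ 2 ≤
    L * c ^ 2 * (a * (#S - a) / #S)

open Classical in
theorem card_not_isTypical_le {S : Finset α} {f : α → ℝ} {A c L : ℝ} (hL : 0 ≤ L) (hc : 0 ≤ c)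
    (hf : ∀ i ∈ S, f i ∈ Set.Icc A (A + c)) :
    (#{l ∈ orderings S | ¬ IsTypical f S c L l} : ℝ) ≤
      #S * (2 * Real.exp (-L) * (#S).factorial) := by
  have hsub : {l ∈ orderings S | ¬ IsTypical f S c L l} ⊆
      (Finset.Ioc 0 #S).biUnion fun a => {l ∈ orderings S | L * c ^ 2 * (a * (#S - a) / #S) <
        (((l.take a).map f).sum - a * ((∑ j ∈ S, f j) / #S)) ^ 2} := by
    intro l hl
    rw [Finset.mem_filter, IsTypical] at hl
    push Not at hl
    obtain ⟨hl, a, ha, h⟩ := hl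
    rw [Finset.mem_biUnion]
    refine ⟨a, Finset.mem_Ioc.2 ⟨?_, ha⟩, Finset.mem_filter.2 ⟨hl, h⟩⟩
    rcases Nat.eq_zero_or_pos a with rfl | h0
    · simp at h
    · exact h0
  calc (#{l ∈ orderings S | ¬ IsTypical f S c L l} : ℝ)
      ≤ ∑ a ∈ Finset.Ioc 0 #S, (#{l ∈ orderings S | L * c ^ 2 * (a * (#S - a) / #S) <
        (((l.take a).map f).sum - a * ((∑ j ∈ S, f j) / #S)) ^ 2} : ℝ) := by
        exact_mod_cast (Finset.card_le_card hsub).trans Finset.card_biUnion_le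
    _ ≤ ∑ a ∈ Finset.Ioc 0 #S, (2 * Real.exp (-L) * (#S).factorial) := by
        refine Finset.sum_le_sum fun a ha => ?_
        exact card_deviation_le hL hc hf (Finset.mem_Ioc.1 ha).2
    _ = _ := by simp

theorem choose_mul_factorial_le_of_isTypical {f : α → ℝ} {Sp Sn : Finset α} {cp cn : ℝ}
    (hcp : 0 ≤ cp) (hcn : 0 ≤ cn) (hc : cp + cn = 2)
    (hSp : ∀ B ∈ Sp, 5 / 2 ≤ f B) (hSn : ∀ B ∈ Sn, f B ≤ -(5 / 2)) {P₁ P₂ N₁ N₂ : List α}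
    (hP : P₁ ++ P₂ ∈ orderings Sp) (hN : N₁ ++ N₂ ∈ orderings Sn)
    (hpos : Sp.Nonempty) (hneg : Sn.Nonempty)
    (tP : IsTypical f Sp cp (Real.log (4 * (#Sp + #Sn))) (P₁ ++ P₂))
    (tN : IsTypical f Sn cn (Real.log (4 * (#Sp + #Sn))) (N₁ ++ N₂))
    (hx : |(P₁.map f).sum + (N₁.map f).sum| ≤ 9 / 2)
    (hT : |∑ B ∈ Sp, f B + ∑ B ∈ Sn, f B| ≤ 5 / 2) :
    ((#Sp + #Sn).choose #Sp : ℝ) *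
      (P₁.length.factorial * N₁.length.factorial *
        (P₂.length.factorial * N₂.length.factorial)) ≤
      100 * Real.exp 48 * ((#Sp + #Sn : ℝ) ^ 2 + 1) *
        ((P₁.length + N₁.length).factorial * (P₂.length + N₂.length).factorial) := by
  have lP : #Sp = P₁.length + P₂.length := by
    rw [← length_of_mem_orderings hP, List.length_append]
  have lN : #Sn = N₁.length + N₂.length := by
    rw [← length_of_mem_orderings hN, List.length_append]
  have cP : (0 : ℝ) < #Sp := by exact_mod_cast hpos.card_pos
  have cN : (0 : ℝ) < #Sn := by exact_mod_cast hneg.card_pos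
  have h1 := tP P₁.length (by omega)
  have h2 := tN N₁.length (by omega)
  rw [List.take_left] at h1 h2
  have mP : 5 / 2 ≤ (∑ B ∈ Sp, f B) / #Sp := by
    rw [le_div_iff₀ cP, mul_comm, ← nsmul_eq_mul]
    exact Finset.card_nsmul_le_sum _ _ _ hSp
  have mN : 5 / 2 ≤ -((∑ B ∈ Sn, f B) / #Sn) := by
    rw [← neg_div, le_div_iff₀ cN, mul_comm, ← nsmul_eq_mul, ← Finset.sum_neg_distrib]
    exact Finset.card_nsmul_le_sum _ _ _ fun B hB => by linarith [hSn B hB]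
  have sP : (#Sp : ℝ) * ((∑ B ∈ Sp, f B) / #Sp) = ∑ B ∈ Sp, f B := mul_div_cancel₀ _ cP.ne'
  have sN : (#Sn : ℝ) * ((∑ B ∈ Sn, f B) / #Sn) = ∑ B ∈ Sn, f B := mul_div_cancel₀ _ cN.ne'
  set p := (∑ B ∈ Sp, f B) / #Sp
  set q := (∑ B ∈ Sn, f B) / #Sn
  rw [← sP, ← sN] at hT
  rw [lP, lN] at h1 h2 hT
  push_cast at h1 h2 hT
  rw [add_sub_cancel_left] at h1 h2
  have main := choose_mul_factorial_le (a := P₁.length) (a' := P₂.length) (b := N₁.length)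
    (b' := N₂.length) (lP ▸ hpos.card_pos) (lN ▸ hneg.card_pos) mP mN hcp hcn hc h1 h2
    (by
      refine le_trans (le_of_eq ?_) hx
      congr 1
      ring)
    (by
      refine le_trans (le_of_eq ?_) hT
      congr 1
      ring)
  rw [lP, lN]
  push_cast
  exact main

omit [DecidableEq α] in
theorem filter_append_mid (p : α → Prop) [DecidablePred p] (O₁ O₂ : List α) (B : α) :
    (O₁ ++ B :: O₂).filter p =
      if p B then O₁.filter p ++ B :: O₂.filter p else O₁.filter p ++ O₂.filter p := by
  rw [List.filter_append, List.filter_cons]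
  by_cases h : p B <;> simp [h]

omit [DecidableEq α] in
theorem sum_filter_add_sum_filter_not_list (p : α → Prop) [DecidablePred p] (f : α → ℝ)
    (O : List α) :
    ((O.filter p).map f).sum + ((O.filter fun B => ¬ p B).map f).sum = (O.map f).sum := by
  induction O with
  | nil => simp
  | cons B O ih =>
    by_cases h : p B
    · simp [h, ← ih, add_assoc]
    · simp only [List.filter_cons, h, decide_false, decide_true, not_false_eq_true, if_true,
        List.map_cons, List.sum_cons, ← ih, Bool.false_eq_true, if_false]
      ring

omit [DecidableEq α] in
theorem length_filter_add_length_filter_not (p : α → Prop) [DecidablePred p] (O : List α) :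
    (O.filter p).length + (O.filter fun B => ¬ p B).length = O.length := by
  induction O with
  | nil => simp
  | cons B O ih =>
    by_cases h : p B
    · simp only [List.filter_cons, h, decide_false, decide_true, not_true_eq_false, if_true,
        List.length_cons, ← ih, Bool.false_eq_true, if_false]
      ring
    · simp only [List.filter_cons, h, decide_false, decide_true, not_false_eq_true, if_true,
        List.length_cons, ← ih, Bool.false_eq_true, if_false]
      ring

theorem factorial_ratio_le {C F x y z : ℝ} {a b : ℕ} (hF : 0 ≤ F) (hz : 0 ≤ z)
    (hb : (b : ℝ) ≤ 5 * (a + 1))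
    (h : C * (x * ((a + 1).factorial * y)) ≤ F * (z * (a + 1 + b).factorial)) :
    C * (x * (a.factorial * y)) ≤ 6 * F * (z * (a + b).factorial) := by
  rw [show a + 1 + b = (a + b) + 1 by ring, Nat.factorial_succ, Nat.factorial_succ] at h
  push_cast at h
  have h0 : (0 : ℝ) < a + 1 := by positivity
  refine le_of_mul_le_mul_left ?_ h0
  calc (a + 1 : ℝ) * (C * (x * (a.factorial * y))) = C * (x * ((a + 1) * a.factorial * y)) := by
        ring
    _ ≤ F * (z * ((a + b + 1) * (a + b).factorial)) := h
    _ ≤ F * (z * ((6 * (a + 1)) * (a + b).factorial)) := by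
        gcongr
        linarith
    _ = _ := by ring

theorem choose_mul_factorial_le_of_cut {f : α → ℝ} {S : Finset α} {cp cn : ℝ}
    (hcp : 0 ≤ cp) (hcn : 0 ≤ cn) (hc : cp + cn = 2)
    (hS : ∀ B ∈ S, 5 / 2 ≤ f B ∧ f B ≤ 5 / 2 + cp ∨ -(5 / 2 + cn) ≤ f B ∧ f B ≤ -(5 / 2))
    (hT : |∑ B ∈ S, f B| < 5 / 2) {O₁ O₂ : List α} {β : Option α}
    (hO : O₁ ++ β.toList ++ O₂ ∈ orderings S) (hβ : β = none → O₂ = [])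
    (hA : Alternates f 0 (O₁ ++ β.toList ++ O₂))
    (tP : IsTypical f {B ∈ S | 0 < f B} cp
      (Real.log (4 * (#{B ∈ S | 0 < f B} + #{B ∈ S | ¬ 0 < f B})))
      ((O₁ ++ β.toList ++ O₂).filter fun B => 0 < f B))
    (tN : IsTypical f {B ∈ S | ¬ 0 < f B} cn
      (Real.log (4 * (#{B ∈ S | 0 < f B} + #{B ∈ S | ¬ 0 < f B})))
      ((O₁ ++ β.toList ++ O₂).filter fun B => ¬ 0 < f B)) :
    ((#{B ∈ S | 0 < f B} + #{B ∈ S | ¬ 0 < f B}).choose #{B ∈ S | 0 < f B} : ℝ) *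
      ((O₁.filter fun B => 0 < f B).length.factorial *
        (O₁.filter fun B => ¬ 0 < f B).length.factorial *
        ((O₂.filter fun B => 0 < f B).length.factorial *
          (O₂.filter fun B => ¬ 0 < f B).length.factorial)) ≤
      600 * Real.exp 48 * ((#{B ∈ S | 0 < f B} + #{B ∈ S | ¬ 0 < f B} : ℝ) ^ 2 + 1) *
        (O₁.length.factorial * O₂.length.factorial) := by
  have hP := filter_mem_orderings hO fun B => 0 < f B
  have hN := filter_mem_orderings hO fun B => ¬ 0 < f B
  have hSp : ∀ B ∈ S.filter (fun B => 0 < f B), 5 / 2 ≤ f B ∧ f B ≤ 5 / 2 + cp := by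
    intro B hB
    rw [Finset.mem_filter] at hB
    rcases hS B hB.1 with h | h
    · exact h
    · linarith [hB.2]
  have hSn : ∀ B ∈ S.filter (fun B => ¬ 0 < f B), -(5 / 2 + cn) ≤ f B ∧ f B ≤ -(5 / 2) := by
    intro B hB
    rw [Finset.mem_filter] at hB
    rcases hS B hB.1 with h | h
    · linarith [hB.2]
    · exact h
  have hsum := Finset.sum_filter_add_sum_filter_not S (fun B => 0 < f B) f
  set Sp := S.filter (fun B => 0 < f B) with hSpdef
  set Sn := S.filter (fun B => ¬ 0 < f B) with hSndef
  have hexp : (1 : ℝ) ≤ Real.exp 48 := Real.one_le_exp (by norm_num)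
  cases β with
  | none =>
    obtain rfl := hβ rfl
    have lP := length_of_mem_orderings hP
    have lN := length_of_mem_orderings hN
    have l1 := length_filter_add_length_filter_not (fun B => 0 < f B) O₁
    simp only [Option.toList_none, List.append_nil] at lP lN
    rw [lP, lN] at l1
    simp only [List.filter_nil, List.length_nil, Nat.factorial_zero, Nat.cast_one, mul_one]
    rw [lP, lN, ← l1]
    have := Nat.choose_mul_factorial_mul_factorial (Nat.le_add_right #Sp #Sn)
    rw [Nat.add_sub_cancel_left, mul_assoc] at this
    have h2 : (((#Sp + #Sn).choose #Sp : ℕ) : ℝ) * ((#Sp).factorial * (#Sn).factorial) =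
        (#Sp + #Sn).factorial := by exact_mod_cast this
    rw [h2]
    refine le_mul_of_one_le_left (by positivity) ?_
    nlinarith [sq_nonneg (#Sp + #Sn : ℝ)]
  | some B =>
    simp only [Option.toList_some, List.append_assoc, List.singleton_append] at *
    have hBS : B ∈ S := (mem_iff_of_mem_orderings hO).1 (by simp)
    have hSne : S.Nonempty := ⟨B, hBS⟩
    have hb2 : ∀ C ∈ O₁ ++ B :: O₂, f C ∈ Set.Icc (-(5 / 2 + cn)) (5 / 2 + cp) := by
      intro C hC
      rw [Set.mem_Icc]
      rcases hS C ((mem_iff_of_mem_orderings hO).1 hC) with h | h <;> constructor <;> linarith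
    have hlev := hA.level_mem hb2 (by constructor <;> linarith) (List.prefix_append O₁ (B :: O₂))
    rw [zero_add, Set.mem_Icc, ← sum_filter_add_sum_filter_not_list fun B => 0 < f B] at hlev
    have hx : |((O₁.filter fun B => 0 < f B).map f).sum +
        ((O₁.filter fun B => ¬ 0 < f B).map f).sum| ≤ 9 / 2 := by
      rw [abs_le]
      constructor <;> linarith
    have hT' := abs_lt.1 hT
    have hpos : Sp.Nonempty := by
      by_contra hne
      rw [Finset.not_nonempty_iff_eq_empty] at hne
      rw [hne, Finset.sum_empty, zero_add] at hsum
      have hn : Sn.Nonempty := by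
        by_contra hn
        rw [Finset.not_nonempty_iff_eq_empty] at hn
        have := Finset.filter_union_filter_not_eq (fun B => 0 < f B) S
        rw [← hSpdef, ← hSndef, hne, hn] at this
        exact hSne.ne_empty (by simpa using this.symm)
      obtain ⟨C, hC⟩ := hn
      have := Finset.sum_le_sum_of_subset_of_nonneg (s := {C}) (t := Sn) (f := fun B => - f B)
        (by simpa using hC) (fun i hi _ => by linarith [(hSn i hi).2])
      rw [Finset.sum_singleton, Finset.sum_neg_distrib, hsum] at this
      linarith [(hSn C hC).2]
    have hneg : Sn.Nonempty := by
      by_contra hne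
      rw [Finset.not_nonempty_iff_eq_empty] at hne
      rw [hne, Finset.sum_empty, add_zero] at hsum
      obtain ⟨C, hC⟩ := hpos
      have := Finset.single_le_sum (s := Sp) (f := f)
        (fun i hi => by linarith [(hSp i hi).1]) hC
      linarith [(hSp C hC).1]
    have htot : (O₁.map f).sum + f B + (O₂.map f).sum = ∑ B ∈ S, f B := by
      rw [← sum_map_of_mem_orderings hO]
      simp [add_assoc]
    rw [← sum_filter_add_sum_filter_not_list (fun B => 0 < f B) f O₁,
      ← sum_filter_add_sum_filter_not_list (fun B => 0 < f B) f O₂] at htot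
    have l1 := length_filter_add_length_filter_not (fun B => 0 < f B) O₁
    have l2 := length_filter_add_length_filter_not (fun B => 0 < f B) O₂
    have memO2 : ∀ C ∈ O₂, C ∈ S := fun C hC => (mem_iff_of_mem_orderings hO).1 (by simp [hC])
    have hO2p : ∀ C ∈ O₂.filter (fun B => 0 < f B), C ∈ Sp := by
      intro C hC
      rw [List.mem_filter] at hC
      exact Finset.mem_filter.2 ⟨memO2 C hC.1, by simpa using hC.2⟩
    have hO2n : ∀ C ∈ O₂.filter (fun B => ¬ 0 < f B), C ∈ Sn := by
      intro C hC
      rw [List.mem_filter] at hC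
      exact Finset.mem_filter.2 ⟨memO2 C hC.1, by simpa using hC.2⟩
    have bp1 := List.sum_le_card_nsmul ((O₂.filter fun B => 0 < f B).map f) (9 / 2)
      (by
        intro x hx
        obtain ⟨C, hC, rfl⟩ := List.mem_map.1 hx
        linarith [(hSp C (hO2p C hC)).2])
    have bp2 := List.card_nsmul_le_sum ((O₂.filter fun B => 0 < f B).map f) (5 / 2)
      (by
        intro x hx
        obtain ⟨C, hC, rfl⟩ := List.mem_map.1 hx
        linarith [(hSp C (hO2p C hC)).1])
    have bn1 := List.sum_le_card_nsmul ((O₂.filter fun B => ¬ 0 < f B).map f) (-(5 / 2))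
      (by
        intro x hx
        obtain ⟨C, hC, rfl⟩ := List.mem_map.1 hx
        linarith [(hSn C (hO2n C hC)).2])
    have bn2 := List.card_nsmul_le_sum ((O₂.filter fun B => ¬ 0 < f B).map f) (-(9 / 2))
      (by
        intro x hx
        obtain ⟨C, hC, rfl⟩ := List.mem_map.1 hx
        linarith [(hSn C (hO2n C hC)).1])
    rw [List.length_map, nsmul_eq_mul] at bp1 bp2 bn1 bn2
    have hT2 : |∑ B ∈ Sp, f B + ∑ B ∈ Sn, f B| ≤ 5 / 2 := by
      rw [hsum]
      exact hT.le
    have key := fun P₁ P₂ N₁ N₂ hP hN => choose_mul_factorial_le_of_isTypical hcp hcn hc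
      (fun B hB => (hSp B hB).1) (fun B hB => (hSn B hB).2) (P₁ := P₁) (P₂ := P₂) (N₁ := N₁)
      (N₂ := N₂) hP hN hpos hneg
    rw [filter_append_mid] at hP hN tP tN
    have hF : (0 : ℝ) ≤ 100 * Real.exp 48 * ((#Sp + #Sn : ℝ) ^ 2 + 1) := by positivity
    rw [← l1, ← l2, show (600 : ℝ) = 6 * 100 by norm_num, mul_assoc 6, mul_assoc 6]
    by_cases hB : 0 < f B
    · rw [if_pos hB] at hP tP
      rw [if_neg (not_not.2 hB)] at hN tN
      have h1 := key _ _ _ _ hP hN tP tN hx hT2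
      rw [List.length_cons] at h1
      refine factorial_ratio_le hF (by positivity) ?_ (h1.trans_eq ?_)
      · have hpB : f B ≤ 5 / 2 + cp :=
          (hSp B (Finset.mem_filter.2 ⟨hBS, hB⟩)).2
        linarith
      · ring
    · rw [if_neg hB] at hP tP
      rw [if_pos hB] at hN tN
      have h1 := key _ _ _ _ hP hN tP tN hx hT2
      rw [List.length_cons] at h1
      rw [mul_comm ((O₂.filter fun B => 0 < f B).length.factorial : ℝ),
        add_comm (O₂.filter fun B => 0 < f B).length]
      refine factorial_ratio_le hF (by positivity) ?_ (le_of_eq_of_le ?_ (h1.trans_eq ?_))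
      · have hpB : -(5 / 2 + cn) ≤ f B :=
          (hSn B (Finset.mem_filter.2 ⟨hBS, hB⟩)).1
        linarith
      · ring
      · ring_nf

end Density

section Merges
open Classical in
theorem card_typical_pairs {α : Type*} [DecidableEq α] {f : α → ℝ} {Sp Sn : Finset α}
    {cp cn A A' : ℝ} (hcp : 0 ≤ cp) (hcn : 0 ≤ cn) (hSp : ∀ B ∈ Sp, f B ∈ Set.Icc A (A + cp))
    (hSn : ∀ B ∈ Sn, f B ∈ Set.Icc A' (A' + cn)) :
    ((#Sp).factorial * (#Sn).factorial : ℝ) ≤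
      2 * #{x ∈ orderings Sp ×ˢ orderings Sn |
        IsTypical f Sp cp (Real.log (4 * (#Sp + #Sn))) x.1 ∧
        IsTypical f Sn cn (Real.log (4 * (#Sp + #Sn))) x.2} := by
  set L := Real.log (4 * (#Sp + #Sn)) with hLdef
  have hL : 0 ≤ L := by
    have : Real.log (4 * (#Sp + #Sn)) = Real.log ((4 * (#Sp + #Sn) : ℕ) : ℝ) := by push_cast; rfl
    rw [hLdef, this]
    exact Real.log_natCast_nonneg _
  have h1 := card_not_isTypical_le hL hcp hSp
  have h2 := card_not_isTypical_le hL hcn hSn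
  set bad := {x ∈ orderings Sp ×ˢ orderings Sn |
    ¬ (IsTypical f Sp cp L x.1 ∧ IsTypical f Sn cn L x.2)} with hbad
  have hsplit := Finset.card_filter_add_card_filter_not (s := orderings Sp ×ˢ orderings Sn)
    (fun x => IsTypical f Sp cp L x.1 ∧ IsTypical f Sn cn L x.2)
  rw [← hbad, Finset.card_product, card_orderings, card_orderings] at hsplit
  have hsub : bad ⊆ {l ∈ orderings Sp | ¬ IsTypical f Sp cp L l} ×ˢ orderings Sn ∪
      orderings Sp ×ˢ {l ∈ orderings Sn | ¬ IsTypical f Sn cn L l} := by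
    intro x hx
    simp only [hbad, Finset.mem_filter, Finset.mem_product, Finset.mem_union] at hx ⊢
    tauto
  have h3 := (Finset.card_le_card hsub).trans (Finset.card_union_le _ _)
  rw [Finset.card_product, Finset.card_product, card_orderings, card_orderings] at h3
  have h3' : (#bad : ℝ) ≤ #{l ∈ orderings Sp | ¬ IsTypical f Sp cp L l} * (#Sn).factorial +
      (#Sp).factorial * #{l ∈ orderings Sn | ¬ IsTypical f Sn cn L l} := by exact_mod_cast h3
  have h4 : (#bad : ℝ) ≤ ((#Sp + #Sn) * Real.exp (-L)) *
      (2 * ((#Sp).factorial * (#Sn).factorial)) := by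
    calc (#bad : ℝ) ≤ (#Sp * (2 * Real.exp (-L) * (#Sp).factorial)) * (#Sn).factorial +
        (#Sp).factorial * (#Sn * (2 * Real.exp (-L) * (#Sn).factorial)) := by
          refine h3'.trans ?_
          gcongr
      _ = _ := by ring
  have h5 : (#Sp + #Sn : ℝ) * Real.exp (-L) ≤ 1 / 4 := by
    rcases Nat.eq_zero_or_pos (#Sp + #Sn) with h0 | h0
    · have : (#Sp + #Sn : ℝ) = 0 := by exact_mod_cast h0
      rw [this]
      norm_num
    · have : (0 : ℝ) < #Sp + #Sn := by exact_mod_cast h0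
      rw [Real.exp_neg, hLdef, Real.exp_log (by positivity)]
      field_simp
      norm_num
  have hsplit' : (#{x ∈ orderings Sp ×ˢ orderings Sn |
      IsTypical f Sp cp L x.1 ∧ IsTypical f Sn cn L x.2} : ℝ) + #bad =
      (#Sp).factorial * (#Sn).factorial := by exact_mod_cast hsplit
  have h6 : ((#Sp + #Sn) * Real.exp (-L)) *
      (2 * ((#Sp).factorial * (#Sn).factorial)) ≤
      1 / 4 * (2 * ((#Sp).factorial * (#Sn).factorial) : ℝ) := by gcongr
  linarith

variable {ι : Type*} [DecidableEq ι]

theorem card_take_fiber_le {S : Finset (List ι)} {𝒪 : Finset (List (List ι))} {C F : ℝ}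
    {p : List ι → Prop} [DecidablePred p] (hC : 0 ≤ C) (hF : 0 ≤ F) (hsub : 𝒪 ⊆ orderings S)
    (hinj : ∀ O ∈ 𝒪, ∀ O' ∈ 𝒪, O.filter p = O'.filter p →
      O.filter (fun B => ¬ p B) = O'.filter (fun B => ¬ p B) → O = O')
    (hcut : ∀ O₁ β O₂, O₁ ++ Option.toList β ++ O₂ ∈ 𝒪 → (β = none → O₂ = []) →
      C * ((O₁.filter p).length.factorial * (O₁.filter fun B => ¬ p B).length.factorial *
        ((O₂.filter p).length.factorial * (O₂.filter fun B => ¬ p B).length.factorial)) ≤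
      F * (O₁.length.factorial * O₂.length.factorial)) (k : ℕ) (ρ : List ι) (U : Finset ι) :
    C * #{O ∈ 𝒪 | ((O.flatten ++ ρ).take k).toFinset = U} ≤
      F * #{O ∈ orderings S | ((O.flatten ++ ρ).take k).toFinset = U} := by
  choose pre mid post hpm using exists_isCut (ι := ι) k
  let key : List (List ι) → Finset (List ι) × Option (List ι) × Finset (List ι) :=
    fun O => ((pre O).toFinset, mid O, (post O).toFinset)
  have nd : ∀ O ∈ orderings S, (pre O).Nodup ∧ (post O).Nodup := by
    intro O hO
    have := (mem_orderings.1 hO).1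
    rw [(hpm O).1] at this
    exact ⟨this.sublist (List.sublist_append_of_sublist_left (List.sublist_append_left _ _)),
      this.sublist (List.sublist_append_right _ _)⟩
  have h1 := Finset.card_eq_sum_card_fiberwise (f := key)
    (s := {O ∈ 𝒪 | ((O.flatten ++ ρ).take k).toFinset = U}) (t := (orderings S).image key)
    (fun O hO => by
      simp only [Finset.coe_filter, Set.mem_ofPred_eq] at hO
      exact Finset.mem_coe.2 (Finset.mem_image_of_mem key (hsub hO.1)))
  have h2 := Finset.card_eq_sum_card_fiberwise (f := key)
    (s := {O ∈ orderings S | ((O.flatten ++ ρ).take k).toFinset = U})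
    (t := (orderings S).image key)
    (fun O hO => by
      simp only [Finset.coe_filter, Set.mem_ofPred_eq] at hO
      exact Finset.mem_coe.2 (Finset.mem_image_of_mem key hO.1))
  rw [h1, h2]
  push_cast
  rw [Finset.mul_sum, Finset.mul_sum]
  refine Finset.sum_le_sum fun κ _ => ?_
  rcases Finset.eq_empty_or_nonempty
    {O ∈ {O ∈ 𝒪 | ((O.flatten ++ ρ).take k).toFinset = U} | key O = κ} with he | ⟨O₀, hO₀⟩
  · rw [he]
    simp only [Finset.card_empty, Nat.cast_zero, mul_zero]
    positivity
  · simp only [Finset.mem_filter] at hO₀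
    obtain ⟨⟨hO, hU⟩, rfl⟩ := hO₀
    have hcut0 := hpm O₀
    have nd0 := nd O₀ (hsub hO)
    have hmain := hcut (pre O₀) (mid O₀) (post O₀) (by rw [← hcut0.1]; exact hO) hcut0.2.2.2
    have upper : #{O ∈ {O ∈ 𝒪 | ((O.flatten ++ ρ).take k).toFinset = U} | key O = key O₀} ≤
        ((pre O₀).filter p).length.factorial *
          ((pre O₀).filter fun B => ¬ p B).length.factorial *
        (((post O₀).filter p).length.factorial *
          ((post O₀).filter fun B => ¬ p B).length.factorial) := by
      have m1 := filter_mem_orderings (mem_orderings_self nd0.1) p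
      have m2 := filter_mem_orderings (mem_orderings_self nd0.1) fun B => ¬ p B
      have m3 := filter_mem_orderings (mem_orderings_self nd0.2) p
      have m4 := filter_mem_orderings (mem_orderings_self nd0.2) fun B => ¬ p B
      rw [length_of_mem_orderings m1, length_of_mem_orderings m2, length_of_mem_orderings m3,
        length_of_mem_orderings m4]
      simp only [← card_orderings, ← Finset.card_product]
      refine Finset.card_le_card_of_injOn (fun O => (((pre O).filter p,
        (pre O).filter fun B => ¬ p B), ((post O).filter p,
        (post O).filter fun B => ¬ p B))) ?_ ?_
      · intro O hO'
        simp only [Finset.coe_filter, Finset.mem_filter, Set.mem_ofPred_eq] at hO'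
        obtain ⟨⟨h3, -⟩, h4⟩ := hO'
        simp only [key, Prod.mk.injEq] at h4
        have nd1 := nd O (hsub h3)
        have e1 : pre O ∈ orderings (pre O₀).toFinset := h4.1 ▸ mem_orderings_self nd1.1
        have e2 : post O ∈ orderings (post O₀).toFinset := h4.2.2 ▸ mem_orderings_self nd1.2
        simp only [Finset.coe_product, Set.mem_prod, Finset.mem_coe]
        exact ⟨⟨filter_mem_orderings e1 _, filter_mem_orderings e1 _⟩,
          ⟨filter_mem_orderings e2 _, filter_mem_orderings e2 _⟩⟩
      · intro O hO' O' hO'' h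
        simp only [Finset.coe_filter, Finset.mem_filter, Set.mem_ofPred_eq] at hO' hO''
        simp only [Prod.mk.injEq] at h
        have k1 := hO'.2
        have k2 := hO''.2
        simp only [key, Prod.mk.injEq] at k1 k2
        refine hinj O hO'.1.1 O' hO''.1.1 ?_ ?_
        · rw [(hpm O).1, (hpm O').1, k1.2.1, k2.2.1]
          simp only [List.filter_append]
          rw [h.1.1, h.2.1]
        · rw [(hpm O).1, (hpm O').1, k1.2.1, k2.2.1]
          simp only [List.filter_append]
          rw [h.1.2, h.2.2]
    have lower : (pre O₀).length.factorial * (post O₀).length.factorial ≤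
        #{O ∈ {O ∈ orderings S | ((O.flatten ++ ρ).take k).toFinset = U} | key O = key O₀} := by
      rw [length_of_mem_orderings (mem_orderings_self nd0.1),
        length_of_mem_orderings (mem_orderings_self nd0.2), ← card_orderings, ← card_orderings,
        ← Finset.card_product]
      refine Finset.card_le_card_of_injOn
        (fun x => x.1 ++ (mid O₀).toList ++ x.2) ?_ ?_
      · rintro ⟨x, y⟩ hxy
        simp only [Finset.coe_product, Set.mem_prod, Finset.mem_coe] at hxy
        have px := perm_of_mem_orderings hxy.1 (mem_orderings_self nd0.1)
        have py := perm_of_mem_orderings hxy.2 (mem_orderings_self nd0.2)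
        have hc := hcut0.of_perm px py
        obtain ⟨u1, u2, u3⟩ := hc.unique (hpm _)
        simp only [Finset.coe_filter, Finset.mem_filter, Set.mem_ofPred_eq]
        refine ⟨⟨mem_orderings_of_perm (hsub hO) ?_, ?_⟩, ?_⟩
        · nth_rw 2 [hcut0.1]
          exact (px.append_right _).append py
        · rw [← hU]
          exact hc.toFinset_take hcut0 px ρ
        · simp only [key, Prod.mk.injEq]
          rw [← u1, ← u2, ← u3]
          exact ⟨List.toFinset_eq_of_perm _ _ px, rfl, List.toFinset_eq_of_perm _ _ py⟩
      · rintro ⟨x, y⟩ hxy ⟨x', y'⟩ hxy' h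
        simp only [Finset.coe_product, Set.mem_prod, Finset.mem_coe] at hxy hxy'
        simp only [List.append_assoc] at h
        have e1 := List.append_inj h (by
          rw [length_of_mem_orderings hxy.1, length_of_mem_orderings hxy'.1])
        rw [e1.1, List.append_cancel_left e1.2]
    have upper' : (#{O ∈ {O ∈ 𝒪 | ((O.flatten ++ ρ).take k).toFinset = U} | key O = key O₀} : ℝ) ≤
        ((pre O₀).filter p).length.factorial *
          ((pre O₀).filter fun B => ¬ p B).length.factorial *
        (((post O₀).filter p).length.factorial *
          ((post O₀).filter fun B => ¬ p B).length.factorial) := by exact_mod_cast upper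
    have lower' : ((pre O₀).length.factorial * (post O₀).length.factorial : ℝ) ≤
        #{O ∈ {O ∈ orderings S | ((O.flatten ++ ρ).take k).toFinset = U} | key O = key O₀} := by
      exact_mod_cast lower
    exact (mul_le_mul_of_nonneg_left upper' hC).trans
      (hmain.trans (mul_le_mul_of_nonneg_left lower' hF))

/-- Many alternating orderings of a set of blocks, spread almost evenly. -/
theorem exists_alternating_orderings {f : List ι → ℝ} {S : Finset (List ι)} {cp cn : ℝ}
    (hcp : 0 ≤ cp) (hcn : 0 ≤ cn) (hc : cp + cn = 2)
    (hS : ∀ B ∈ S, 5 / 2 ≤ f B ∧ f B ≤ 5 / 2 + cp ∨ -(5 / 2 + cn) ≤ f B ∧ f B ≤ -(5 / 2))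
    (hT : |∑ B ∈ S, f B| < 5 / 2) :
    ∃ 𝒪 ⊆ orderings S, ∃ C : ℝ, 0 ≤ C ∧ (∀ O ∈ 𝒪, Alternates f 0 O) ∧
      (#S).factorial ≤ 2 * (C * #𝒪) ∧
      ∀ (k : ℕ) (ρ : List ι) (U : Finset ι),
        C * #{O ∈ 𝒪 | ((O.flatten ++ ρ).take k).toFinset = U} ≤
          600 * Real.exp 48 * ((#S : ℝ) ^ 2 + 1) *
            #{O ∈ orderings S | ((O.flatten ++ ρ).take k).toFinset = U} := by
  classical
  set Sp := S.filter (fun B => 0 < f B) with hSpdef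
  set Sn := S.filter (fun B => ¬ 0 < f B) with hSndef
  have hSp : ∀ B ∈ Sp, f B ∈ Set.Icc (5 / 2) (5 / 2 + cp) := by
    intro B hB
    rw [Finset.mem_filter] at hB
    rcases hS B hB.1 with h | h
    · exact h
    · linarith [hB.2]
  have hSn : ∀ B ∈ Sn, f B ∈ Set.Icc (-(5 / 2 + cn)) (-(5 / 2 + cn) + cn) := by
    intro B hB
    rw [Finset.mem_filter] at hB
    rcases hS B hB.1 with h | h
    · linarith [hB.2]
    · exact ⟨h.1, by linarith [h.2]⟩
  have hcard : #Sp + #Sn = #S := Finset.card_filter_add_card_filter_not _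
  have hcard' : (#Sp + #Sn : ℝ) = #S := by exact_mod_cast hcard
  have hsum : ∑ B ∈ Sp, f B + ∑ B ∈ Sn, f B = ∑ B ∈ S, f B :=
    Finset.sum_filter_add_sum_filter_not S (fun B => 0 < f B) f
  have hex : ∀ x ∈ orderings Sp ×ˢ orderings Sn, ∃ O : List (List ι),
      O.filter (fun B => 0 < f B) = x.1 ∧ O.filter (fun B => ¬ 0 < f B) = x.2 ∧
        Alternates f 0 O := by
    rintro ⟨P, N⟩ hx
    rw [Finset.mem_product] at hx
    refine exists_alternates (K := 5 / 2) (by norm_num) ?_ ?_ ?_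
    · intro B hB
      exact (hSp B ((mem_iff_of_mem_orderings hx.1).1 hB)).1
    · intro B hB
      linarith [(hSn B ((mem_iff_of_mem_orderings hx.2).1 hB)).2]
    · rw [sum_map_of_mem_orderings hx.1, sum_map_of_mem_orderings hx.2, zero_add, hsum]
      exact hT
  choose! Γ hΓp hΓn hΓA using hex
  set L := Real.log (4 * (#Sp + #Sn)) with hL
  set 𝒢 := {x ∈ orderings Sp ×ˢ orderings Sn |
    IsTypical f Sp cp L x.1 ∧ IsTypical f Sn cn L x.2} with h𝒢
  have h𝒢mem : ∀ x ∈ 𝒢, x ∈ orderings Sp ×ˢ orderings Sn := fun x hx =>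
    (Finset.mem_filter.1 hx).1
  have hΓS : ∀ x ∈ 𝒢, Γ x ∈ orderings S := by
    intro x hx
    have hx' := h𝒢mem x hx
    have hx2 := Finset.mem_product.1 hx'
    exact mem_orderings_of_filter (fun B => 0 < f B) (by rw [hΓp x hx']; exact hx2.1)
      (by rw [hΓn x hx']; exact hx2.2)
  have hsub : 𝒢.image Γ ⊆ orderings S := by
    intro O hO
    obtain ⟨x, hx, rfl⟩ := Finset.mem_image.1 hO
    exact hΓS x hx
  have hinj : Set.InjOn Γ 𝒢 := by
    intro x hx y hy h
    have hx' := h𝒢mem x hx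
    have hy' := h𝒢mem y hy
    exact Prod.ext (by rw [← hΓp x hx', h, hΓp y hy']) (by rw [← hΓn x hx', h, hΓn y hy'])
  refine ⟨𝒢.image Γ, hsub, ((#Sp + #Sn).choose #Sp : ℝ), by positivity, ?_, ?_, ?_⟩
  · intro O hO
    obtain ⟨x, hx, rfl⟩ := Finset.mem_image.1 hO
    exact hΓA x (h𝒢mem x hx)
  · rw [Finset.card_image_of_injOn hinj]
    have h1 := card_typical_pairs hcp hcn hSp hSn
    have h2 := Nat.choose_mul_factorial_mul_factorial (Nat.le_add_right #Sp #Sn)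
    rw [Nat.add_sub_cancel_left, mul_assoc] at h2
    have h3 : (((#Sp + #Sn).choose #Sp : ℕ) : ℝ) * ((#Sp).factorial * (#Sn).factorial) =
        (#Sp + #Sn).factorial := by exact_mod_cast h2
    rw [← hcard, ← h3]
    calc _ ≤ (((#Sp + #Sn).choose #Sp : ℕ) : ℝ) * (2 * #𝒢) := by gcongr
      _ = _ := by ring
  · intro k ρ U
    refine card_take_fiber_le (p := fun B => 0 < f B) (by positivity) (by positivity) hsub
      ?_ ?_ k ρ U
    · intro O hO O' hO' h1 h2
      obtain ⟨x, hx, rfl⟩ := Finset.mem_image.1 hO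
      obtain ⟨y, hy, rfl⟩ := Finset.mem_image.1 hO'
      have hx' := h𝒢mem x hx
      have hy' := h𝒢mem y hy
      rw [hΓp x hx', hΓp y hy'] at h1
      rw [hΓn x hx', hΓn y hy'] at h2
      rw [Prod.ext h1 h2]
    · intro O₁ β O₂ hO hβ
      obtain ⟨x, hx, hxO⟩ := Finset.mem_image.1 hO
      have hx' := h𝒢mem x hx
      have ht := (Finset.mem_filter.1 hx).2
      have := choose_mul_factorial_le_of_cut hcp hcn hc hS hT (hsub hO) hβ
        (hxO ▸ hΓA x hx') (by rw [← hxO, hΓp x hx']; exact ht.1)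
        (by rw [← hxO, hΓn x hx']; exact ht.2)
      rw [← hSpdef, ← hSndef, hcard'] at this
      exact this

end Merges

section Centred
variable {ι : Type*} [DecidableEq ι]

/-- `ν` is an `a`-uniform probability distribution on the orderings of `s`. -/
def IsAlmostUniform (s : Finset ι) (a : ℝ) (ν : List ι → ℝ) : Prop :=
  (∀ l, 0 ≤ ν l) ∧ ∑ l ∈ orderings s, ν l = 1 ∧ ∀ k ≤ #s, ∀ U : Finset ι,
    (#s).factorial * ∑ l ∈ orderings s with (l.take k).toFinset = U, ν l ≤
      a * (k.factorial * (#s - k).factorial)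

theorem exists_isAlmostUniform {X : Type*} {s : Finset ι} {D : Finset X} {c : X → ℝ}
    {g : X → List ι} {a b : ℝ} (hg : ∀ x ∈ D, g x ∈ orderings s) (hc : ∀ x ∈ D, 0 ≤ c x)
    (hZ : ((#s).factorial : ℝ) ≤ b * ∑ x ∈ D, c x)
    (hU : ∀ k ≤ #s, ∀ U : Finset ι, ∑ x ∈ D with ((g x).take k).toFinset = U, c x ≤
      a * (k.factorial * (#s - k).factorial)) :
    ∃ ν, IsAlmostUniform s (b * a) ν ∧ ∀ l, 0 < ν l → ∃ x ∈ D, 0 < c x ∧ g x = l := by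
  set Z := ∑ x ∈ D, c x with hZdef
  have hfac : (0 : ℝ) < (#s).factorial := by positivity
  have hZ0 : 0 ≤ Z := Finset.sum_nonneg hc
  have hZpos : 0 < Z := by
    rcases hZ0.lt_or_eq with h | h
    · exact h
    · rw [← h, mul_zero] at hZ
      linarith
  have hcn : ∀ l, 0 ≤ ∑ x ∈ D with g x = l, c x := fun l =>
    Finset.sum_nonneg fun x hx => hc x (Finset.mem_filter.1 hx).1
  refine ⟨fun l => (∑ x ∈ D with g x = l, c x) / Z, ⟨?_, ?_, ?_⟩, ?_⟩
  · intro l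
    exact div_nonneg (hcn l) hZ0
  · rw [← Finset.sum_div, Finset.sum_fiberwise_of_maps_to hg, div_self hZpos.ne']
  · intro k hk U
    have h1 : ∑ l ∈ orderings s with (l.take k).toFinset = U, (∑ x ∈ D with g x = l, c x) =
        ∑ x ∈ D with ((g x).take k).toFinset = U, c x := by
      rw [← Finset.sum_fiberwise_of_maps_to (s := {x ∈ D | ((g x).take k).toFinset = U}) (g := g)
        (t := {l ∈ orderings s | (l.take k).toFinset = U})]
      · refine Finset.sum_congr rfl fun l hl => ?_
        refine Finset.sum_congr ?_ fun _ _ => rfl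
        rw [Finset.filter_filter]
        refine Finset.filter_congr fun x _ => ?_
        constructor
        · rintro rfl
          exact ⟨(Finset.mem_filter.1 hl).2, rfl⟩
        · exact fun h => h.2
      · intro x hx
        rw [Finset.mem_filter] at hx ⊢
        exact ⟨hg x hx.1, hx.2⟩
    rw [← Finset.sum_div, h1, mul_div_assoc', div_le_iff₀ hZpos]
    calc _ ≤ (b * Z) * (a * (k.factorial * (#s - k).factorial)) :=
          mul_le_mul hZ (hU k hk U)
            (Finset.sum_nonneg fun x hx => hc x (Finset.mem_filter.1 hx).1) (hfac.le.trans hZ)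
      _ = _ := by ring
  · intro l hl
    by_contra! hne
    refine absurd hl (not_lt.2 (div_nonpos_of_nonpos_of_nonneg ?_ hZ0))
    refine Finset.sum_nonpos fun x hx => ?_
    rw [Finset.mem_filter] at hx
    by_contra! h
    exact hne x hx.1 h hx.2

omit [DecidableEq ι] in
theorem listWeight_sub_const (w : ι → ℝ) (c : ℝ) (l : List ι) :
    listWeight (fun i => w i - c) l = listWeight w l - l.length * c := by
  induction l with
  | nil => simp
  | cons i l ih =>
    rw [listWeight_cons, listWeight_cons, ih]
    push_cast [List.length_cons]
    ring

omit [DecidableEq ι] in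
theorem IsBlock.weight_mem {w : ι → ℝ} {K cp cn : ℝ} {B : List ι} (hB : IsBlock w K B)
    (hw : ∀ i ∈ B, w i ∈ Set.Icc (-cn) cp) :
    K ≤ listWeight w B ∧ listWeight w B ≤ K + cp ∨
      -(K + cn) ≤ listWeight w B ∧ listWeight w B ≤ -K := by
  have h0 := hB.le_abs
  obtain ⟨B', x, rfl, h1, -⟩ := hB
  have h2 := abs_lt.1 (h1 B' (List.prefix_refl _))
  have h3 := hw x (by simp)
  simp only [listWeight_append, listWeight_cons, listWeight_nil, add_zero] at h0 ⊢
  rw [Set.mem_Icc] at h3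
  rcases _root_.le_abs.1 h0 with h | h
  · left
    constructor <;> linarith
  · right
    constructor <;> linarith

omit [DecidableEq ι] in
theorem Alternates.listWeight_take_mem {w : ι → ℝ} {cp cn : ℝ} {O : List (List ι)}
    {ρ : List ι} (hO : Alternates (listWeight w) 0 O) (hcp : 0 ≤ cp) (hcn : 0 ≤ cn)
    (hB : ∀ B ∈ O, IsBlock w (5 / 2) B) (hw : ∀ B ∈ O, ∀ i ∈ B, w i ∈ Set.Icc (-cn) cp)
    (hρ : IsSmall w (5 / 2) ρ) (k : ℕ) :
    listWeight w ((O.flatten ++ ρ).take k) ∈ Set.Icc (-(5 + cn)) (5 + cp) := by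
  obtain ⟨O₁, β, O₂, h⟩ := exists_isCut k O
  rw [h.take_eq, listWeight_append, listWeight_flatten]
  have h1 : 0 + (O₁.map (listWeight w)).sum ∈ Set.Icc (-(5 / 2 + cn)) (5 / 2 + cp) := by
    refine hO.level_mem ?_ ?_ ⟨β.toList ++ O₂, by rw [h.1, List.append_assoc]⟩
    · intro B hBO
      rw [Set.mem_Icc]
      rcases (hB B hBO).weight_mem (hw B hBO) with h | h <;> constructor <;> linarith
    · constructor <;> linarith
  have h2 : |listWeight w ((β.getD ρ).take (k - O₁.flatten.length))| < 5 / 2 := by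
    cases β with
    | none => exact hρ _ (List.take_prefix _ _)
    | some b =>
      refine (hB b (by rw [h.1]; simp)).abs_lt_of_prefix (List.take_prefix _ _) fun he => ?_
      have h3 := congrArg List.length he
      have h4 := h.2.2.1 b rfl
      have h5 := h.2.1
      simp only [Option.getD_some, List.length_take] at h3
      omega
  rw [zero_add, Set.mem_Icc] at h1
  rw [abs_lt] at h2
  constructor <;> linarith

theorem exists_isAlmostUniform_balanced (s : Finset ι) {w : ι → ℝ} (hw : ∀ i ∈ s, |w i| ≤ 1) :
    ∃ ν, IsAlmostUniform s (2 * (600 * Real.exp 48 * ((#s : ℝ) ^ 2 + 1))) ν ∧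
      ∀ l, 0 < ν l → ∀ k, listWeight w (l.take k) ∈
        Set.Icc (min (∑ i ∈ s, w i) 0 - 7) (max (∑ i ∈ s, w i) 0 + 7) := by
  rcases s.eq_empty_or_nonempty with rfl | hs
  · refine ⟨fun l => if l = [] then 1 else 0, ⟨?_, ?_, ?_⟩, ?_⟩
    · intro l
      positivity
    · simp [orderings_empty]
    · intro k _ U
      rw [orderings_empty, Finset.sum_filter, Finset.sum_singleton]
      have h1 : (1 : ℝ) ≤ Real.exp 48 := Real.one_le_exp (by norm_num)
      have h2 : (1 : ℝ) ≤ k.factorial := by exact_mod_cast k.factorial_pos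
      simp
      split_ifs <;> nlinarith
    · intro l hl k
      have : l = [] := by
        by_contra h
        simp [h] at hl
      subst this
      simp
  have hs0 : (0 : ℝ) < #s := by exact_mod_cast hs.card_pos
  set W := ∑ i ∈ s, w i with hW
  set μ := W / #s with hμ
  have hμW : #s * μ = W := by
    rw [hμ]
    field_simp
  have hμ1 : |μ| ≤ 1 := by
    rw [hμ, abs_div, abs_of_pos hs0, div_le_one hs0]
    calc _ ≤ ∑ i ∈ s, |w i| := Finset.abs_sum_le_sum_abs _ _
      _ ≤ ∑ _i ∈ s, (1 : ℝ) := Finset.sum_le_sum hw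
      _ = _ := by simp
  rw [abs_le] at hμ1
  set v : ι → ℝ := fun i => w i - μ with hv
  have hvs : ∀ i ∈ s, v i ∈ Set.Icc (-(1 + μ)) (1 - μ) := by
    intro i hi
    have := abs_le.1 (hw i hi)
    rw [Set.mem_Icc, hv]
    constructor <;> linarith
  have hv0 : ∑ i ∈ s, v i = 0 := by
    rw [hv, Finset.sum_sub_distrib, Finset.sum_const, nsmul_eq_mul, hμW, sub_self]
  obtain ⟨𝒞, h𝒞, hsum⟩ := exists_configurations (w := v) (K := 5 / 2) (by norm_num) s
  have hmem : ∀ c ∈ 𝒞, ∀ B ∈ c.1, ∀ i ∈ B, i ∈ s := by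
    intro c hc B hB i hi
    have hO : c.1.toList ∈ orderings c.1 := mem_orderings.2 ⟨c.1.nodup_toList, by simp⟩
    rw [← mem_iff_of_mem_orderings ((h𝒞 c hc).2.2 _ hO), List.mem_append, List.mem_flatten]
    exact Or.inl ⟨B, by simpa using hB, hi⟩
  have hsumc : ∀ c ∈ 𝒞, |∑ B ∈ c.1, listWeight v B| < 5 / 2 := by
    intro c hc
    have hO : c.1.toList ∈ orderings c.1 := mem_orderings.2 ⟨c.1.nodup_toList, by simp⟩
    have h1 := listWeight_of_mem_orderings (w := v) ((h𝒞 c hc).2.2 _ hO)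
    rw [hv0, listWeight_append, listWeight_flatten, sum_map_of_mem_orderings hO] at h1
    have h2 := (h𝒞 c hc).2.1 _ (List.prefix_refl _)
    rwa [eq_neg_of_add_eq_zero_left h1, abs_neg]
  have hex : ∀ c : Finset (List ι) × List ι, c ∈ 𝒞 → _ := fun c hc =>
    exists_alternating_orderings (f := listWeight v) (S := c.1) (cp := 1 - μ) (cn := 1 + μ)
      (by linarith) (by linarith) (by ring)
      (fun B hB => ((h𝒞 c hc).1 B hB).weight_mem fun i hi => hvs i (hmem c hc B hB i hi))
      (hsumc c hc)
  choose! 𝒪 h𝒪 C hC halt hcard hdens using hex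
  have hcardc : ∀ c ∈ 𝒞, #c.1 ≤ #s := by
    intro c hc
    have hO : c.1.toList ∈ orderings c.1 := mem_orderings.2 ⟨c.1.nodup_toList, by simp⟩
    have h1 := length_of_mem_orderings ((h𝒞 c hc).2.2 _ hO)
    have h2 := length_le_length_flatten (O := c.1.toList) fun B hB =>
      ((h𝒞 c hc).1 B (by simpa using hB)).ne_nil
    rw [List.length_append] at h1
    rw [Finset.length_toList] at h2
    omega
  have huni := exists_isAlmostUniform (s := s) (D := 𝒞.sigma 𝒪)
    (c := fun x => C x.1) (g := fun x => x.2.flatten ++ x.1.2) (b := 2)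
    (a := 600 * Real.exp 48 * ((#s : ℝ) ^ 2 + 1)) ?_ ?_ ?_ ?_
  · obtain ⟨ν, hν, hν'⟩ := huni
    refine ⟨ν, hν, fun l hl k => ?_⟩
    obtain ⟨⟨c, O⟩, hx, -, rfl⟩ := hν' l hl
    obtain ⟨hc, hO⟩ := Finset.mem_sigma.1 hx
    have hOc := h𝒪 c hc hO
    have hBO : ∀ B ∈ O, B ∈ c.1 := fun B hB => (mem_iff_of_mem_orderings hOc).1 hB
    have h1 := (halt c hc O hO).listWeight_take_mem (cp := 1 - μ) (cn := 1 + μ) (by linarith)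
      (by linarith) (fun B hB => (h𝒞 c hc).1 B (hBO B hB))
      (fun B hB i hi => hvs i (hmem c hc B (hBO B hB) i hi)) (h𝒞 c hc).2.1 k
    have hlen := length_of_mem_orderings ((h𝒞 c hc).2.2 O hOc)
    dsimp only at hlen ⊢
    have hlk : ((((O.flatten ++ c.2).take k).length : ℕ) : ℝ) ≤ #s := by
      rw [← hlen]
      exact_mod_cast (List.take_sublist _ _).length_le
    rw [hv, listWeight_sub_const, Set.mem_Icc] at h1
    set n := ((((O.flatten ++ c.2).take k).length : ℕ) : ℝ) with hn
    have hn0 : 0 ≤ n := by positivity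
    rw [Set.mem_Icc]
    rcases le_total 0 W with h0 | h0
    · have hμ0 : 0 ≤ μ := by positivity
      rw [min_eq_right h0, max_eq_left h0]
      constructor <;> nlinarith
    · have hμ0 : μ ≤ 0 := div_nonpos_of_nonpos_of_nonneg h0 hs0.le
      rw [min_eq_left h0, max_eq_right h0]
      constructor <;> nlinarith
  · rintro ⟨c, O⟩ hx
    obtain ⟨hc, hO⟩ := Finset.mem_sigma.1 hx
    exact (h𝒞 c hc).2.2 O (h𝒪 c hc hO)
  · rintro ⟨c, O⟩ hx
    exact hC c (Finset.mem_sigma.1 hx).1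
  · have h1 := hsum fun _ => 1
    simp only [Finset.sum_const, nsmul_eq_mul, mul_one, card_orderings] at h1
    rw [h1, Finset.sum_sigma, Finset.mul_sum]
    refine Finset.sum_le_sum fun c hc => ?_
    dsimp only
    rw [Finset.sum_const, nsmul_eq_mul, mul_comm (#(𝒪 c) : ℝ)]
    exact hcard c hc
  · intro k hk U
    have h1 := hsum fun l => if (l.take k).toFinset = U then 1 else 0
    rw [Finset.sum_boole] at h1
    calc _ = ∑ c ∈ 𝒞, C c * #{O ∈ 𝒪 c | ((O.flatten ++ c.2).take k).toFinset = U} := by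
          rw [Finset.sum_filter, Finset.sum_sigma]
          refine Finset.sum_congr rfl fun c _ => ?_
          dsimp only
          rw [← Finset.sum_filter, Finset.sum_const, nsmul_eq_mul, mul_comm]
      _ ≤ ∑ c ∈ 𝒞, 600 * Real.exp 48 * ((#s : ℝ) ^ 2 + 1) *
            ∑ O ∈ orderings c.1, if ((O.flatten ++ c.2).take k).toFinset = U then 1 else 0 := by
          refine Finset.sum_le_sum fun c hc => (hdens c hc k c.2 U).trans ?_
          rw [Finset.sum_boole]
          have : (#c.1 : ℝ) ≤ #s := by exact_mod_cast hcardc c hc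
          gcongr
      _ = 600 * Real.exp 48 * ((#s : ℝ) ^ 2 + 1) *
            #{l ∈ orderings s | (l.take k).toFinset = U} := by
          rw [h1, Finset.mul_sum]
      _ ≤ _ := by
          have := card_take_eq_le (U := U) hk
          gcongr
          exact_mod_cast this

end Centred

section Positive
variable {ι : Type*}

/-- A block of weight at least `7`. -/
def IsPosBlock (w : ι → ℝ) (B : List ι) : Prop := IsBlock w 7 B ∧ 0 < listWeight w B

variable {w : ι → ℝ}

theorem IsPosBlock.weight_mem {B : List ι} (h : IsPosBlock w B) (hw : ∀ i ∈ B, |w i| ≤ 1) :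
    listWeight w B ∈ Set.Icc 7 8 := by
  rcases h.1.weight_mem (cp := 1) (cn := 1) fun i hi => abs_le.1 (hw i hi) with h1 | h1
  · constructor <;> linarith
  · linarith [h.2]

theorem IsPosBlock.exists_rotation {B : List ι} (h : IsPosBlock w B)
    (hw : ∀ i ∈ B, |w i| ≤ 1) :
    ∃ B' : List ι, B'.Perm B ∧ (∀ k, listWeight w (B'.take k) ∈ Set.Icc 0 15) ∧
      ∀ k ≤ B.length, ∃ i, i + k ≤ B.length ∧ (B'.take k).Perm ((B.drop i).take k) := by
  have hP := h.weight_mem hw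
  rw [Set.mem_Icc] at hP
  obtain ⟨i, hi, hmin⟩ := Finset.exists_min_image (Finset.range (B.length + 1))
    (fun i => listWeight w (B.take i)) ⟨0, by simp⟩
  have hmin0 := hmin 0 (by simp)
  simp only [List.take_zero, listWeight_nil] at hmin0
  have hiB : i < B.length := by
    rw [Finset.mem_range] at hi
    rcases (Nat.lt_succ_iff.1 hi).lt_or_eq with h1 | h1
    · exact h1
    · rw [h1, List.take_length] at hmin0
      linarith
  have hlt : ∀ q < B.length, |listWeight w (B.take q)| < 7 := by
    intro q hq
    refine h.1.abs_lt_of_prefix (List.take_prefix _ _) fun he => ?_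
    have := congrArg List.length he
    rw [List.length_take] at this
    omega
  have hle : ∀ q, listWeight w (B.take q) ≤ 8 := by
    intro q
    rcases lt_or_ge q B.length with hq | hq
    · linarith [(abs_lt.1 (hlt q hq)).2]
    · rw [List.take_of_length_le hq]
      exact hP.2
  have htd : ∀ q, listWeight w (B.drop q) = listWeight w B - listWeight w (B.take q) := by
    intro q
    conv_rhs => rw [← List.take_append_drop q B]
    rw [listWeight_append]
    simp
  have hlong : ∀ k, (B.drop i).length ≤ k → k ≤ B.length →
      ((B.drop i ++ (B.take i).reverse).take k).Perm (B.drop (B.length - k)) := by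
    intro k hk hkB
    rw [List.length_drop] at hk
    rw [List.take_append, List.take_of_length_le (by rw [List.length_drop]; exact hk),
      List.length_drop, List.take_reverse, List.length_take, min_eq_left hiB.le, List.drop_take]
    have h1 : i - (k - (B.length - i)) = B.length - k := by omega
    rw [h1]
    have h2 : B.drop i = (B.drop (B.length - k)).drop (i - (B.length - k)) := by
      rw [List.drop_drop]
      congr 1
      omega
    rw [h2]
    refine ((List.reverse_perm _).append_left _).trans ?_
    refine List.perm_append_comm.trans ?_
    rw [List.take_append_drop]
  have hlenB : (B.drop i ++ (B.take i).reverse).length = B.length := by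
    simp only [List.length_append, List.length_drop, List.length_reverse, List.length_take]
    omega
  have hperm : (B.drop i ++ (B.take i).reverse).Perm B := by
    refine ((List.reverse_perm _).append_left _).trans (List.perm_append_comm.trans ?_)
    rw [List.take_append_drop]
  have hlower := abs_lt.1 (hlt i hiB)
  refine ⟨B.drop i ++ (B.take i).reverse, hperm, ?_, ?_⟩
  · intro k
    rw [Set.mem_Icc]
    rcases le_total k (B.drop i).length with hk | hk
    · rw [List.take_append_of_le_length hk]
      have h1 : listWeight w ((B.drop i).take k) =
          listWeight w (B.take (i + k)) - listWeight w (B.take i) := by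
        rw [List.take_add, listWeight_append]
        ring
      rw [h1]
      rw [List.length_drop] at hk
      have h2 := hmin (i + k) (by rw [Finset.mem_range]; omega)
      have h3 := hle (i + k)
      constructor <;> linarith
    · rcases le_total k B.length with hkB | hkB
      · rw [listWeight_perm (hlong k hk hkB), htd]
        rw [List.length_drop] at hk
        have h1 := abs_lt.1 (hlt (B.length - k) (by omega))
        constructor <;> linarith
      · rw [List.take_of_length_le (by omega), listWeight_perm hperm]
        constructor <;> linarith
  · intro k hkB
    rcases le_total k (B.drop i).length with hk | hk
    · refine ⟨i, ?_, ?_⟩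
      · rw [List.length_drop] at hk
        omega
      · rw [List.take_append_of_le_length hk]
    · refine ⟨B.length - k, by omega, ?_⟩
      have h1 := hlong k hk hkB
      rwa [List.take_of_length_le (l := B.drop (B.length - k)) (by rw [List.length_drop]; omega)]

variable [DecidableEq ι]

theorem card_drop_take_eq_le {s U : Finset ι} {i k : ℕ} (hk : i + k ≤ #s) :
    #{l ∈ orderings s | ((l.drop i).take k).toFinset = U} ≤
      k.factorial * (#s - k).factorial := by
  refine le_trans ?_ (card_take_eq_le (U := U) (by omega : k ≤ #s))
  refine Finset.card_le_card_of_injOn (fun l => l.rotate i) ?_ (List.rotate_injective i).injOn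
  intro l hl
  rw [Finset.mem_coe, Finset.mem_filter] at hl ⊢
  have hlen := length_of_mem_orderings hl.1
  refine ⟨mem_orderings_of_perm hl.1 (List.rotate_perm l i), ?_⟩
  dsimp only
  rw [List.rotate_eq_drop_append_take (by omega),
    List.take_append_of_le_length (by rw [List.length_drop]; omega), hl.2]

theorem sum_factorial_le_of_prefix_free {X : Type*} {s : Finset ι} {T : Finset X}
    {h : X → List ι} (hT : ∀ x ∈ T, (h x).Nodup ∧ (h x).toFinset ⊆ s)
    (hpf : ∀ l, ∀ x ∈ T, ∀ y ∈ T, h x <+: l → h y <+: l → x = y) (Q : List ι → Prop)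
    [DecidablePred Q] (hQ : ∀ x ∈ T, ∀ r, Q (h x ++ r)) :
    ∑ x ∈ T, (#s - (h x).length).factorial ≤ #{l ∈ orderings s | Q l} := by
  have h1 : ∀ x ∈ T, (#s - (h x).length).factorial = #(orderings (s \ (h x).toFinset)) := by
    intro x hx
    rw [card_orderings, Finset.card_sdiff_of_subset (hT x hx).2,
      List.toFinset_card_of_nodup (hT x hx).1]
  rw [Finset.sum_congr rfl h1, ← Finset.card_sigma]
  refine Finset.card_le_card_of_injOn (fun y => h y.1 ++ y.2) ?_ ?_
  · rintro ⟨x, r⟩ hy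
    rw [Finset.mem_coe, Finset.mem_sigma] at hy
    rw [Finset.mem_coe, Finset.mem_filter]
    have := append_mem_orderings (mem_orderings_self (hT x hy.1).1) hy.2 Finset.disjoint_sdiff
    rw [Finset.union_sdiff_of_subset (hT x hy.1).2] at this
    exact ⟨this, hQ x hy.1 r⟩
  · rintro ⟨x, r⟩ hx ⟨y, r'⟩ hy he
    rw [Finset.mem_coe, Finset.mem_sigma] at hx hy
    dsimp only at he hx hy
    obtain rfl := hpf (h x ++ r) x hx.1 y hy.1 ⟨r, rfl⟩ ⟨r', he.symm⟩
    rw [List.append_cancel_left he]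

omit [DecidableEq ι] in
theorem IsBlock.pair_eq_of_prefix {K : ℝ} {A B A' B' l : List ι} (hA : IsBlock w K A)
    (hB : IsBlock w K B) (hA' : IsBlock w K A') (hB' : IsBlock w K B') (h : A ++ B <+: l)
    (h' : A' ++ B' <+: l) : A = A' ∧ B = B' := by
  obtain rfl := hA.eq_of_prefix_of_prefix hA' ((List.prefix_append _ _).trans h)
    ((List.prefix_append _ _).trans h')
  obtain ⟨r, rfl⟩ := h
  rw [List.append_assoc, List.prefix_append_right_inj] at h'
  exact ⟨rfl, hB.eq_of_prefix_of_prefix hB' ⟨r, rfl⟩ h'⟩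

theorem card_pos_pairs_le {S : Finset ι} {p : ι → Prop} [DecidablePred p] (Q : List ι → Prop)
    [DecidablePred Q] (hQ : ∀ a ∈ S, ∀ b ∈ S, ∀ r, p a → p b → Q (a :: b :: r)) :
    (#(S.filter p) * #(S.filter p) - #(S.filter p)) * (#S - 2).factorial ≤
      #{O ∈ orderings S | Q O} := by
  have h1 : (#(S.filter p) * #(S.filter p) - #(S.filter p)) * (#S - 2).factorial =
      ∑ x ∈ (S.filter p).offDiag, #(orderings ((S.erase x.1).erase x.2)) := by
    rw [← Finset.offDiag_card, ← smul_eq_mul, ← Finset.sum_const]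
    refine Finset.sum_congr rfl fun x hx => ?_
    rw [Finset.mem_offDiag, Finset.mem_filter, Finset.mem_filter] at hx
    rw [card_orderings, Finset.card_erase_of_mem (Finset.mem_erase.2 ⟨hx.2.2.symm, hx.2.1.1⟩),
      Finset.card_erase_of_mem hx.1.1, Nat.sub_sub]
  rw [h1, ← Finset.card_sigma]
  refine Finset.card_le_card_of_injOn (fun y => y.1.1 :: y.1.2 :: y.2) ?_ ?_
  · rintro ⟨⟨a, b⟩, r⟩ hy
    simp only [Finset.coe_sigma, Set.mem_sigma_iff, Finset.mem_coe, Finset.mem_offDiag,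
      Finset.mem_filter] at hy ⊢
    obtain ⟨⟨ha, hb, hab⟩, hr⟩ := hy
    exact ⟨cons_mem_orderings.2 ⟨ha.1, cons_mem_orderings.2
      ⟨Finset.mem_erase.2 ⟨Ne.symm hab, hb.1⟩, hr⟩⟩, hQ a ha.1 b hb.1 r ha.2 hb.2⟩
  · rintro ⟨⟨a, b⟩, r⟩ _ ⟨⟨a', b'⟩, r'⟩ _ h
    simp only [List.cons.injEq] at h
    obtain ⟨rfl, rfl, rfl⟩ := h
    rfl

end Positive

section PositiveTotal
variable {ι : Type*} [DecidableEq ι] {w : ι → ℝ}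

theorem factorial_le_card_of_pos_sum {S : Finset ι} {f : ι → ℝ}
    (hS : ∀ B ∈ S, 7 ≤ f B ∧ f B ≤ 8 ∨ f B ≤ -7) (hsum : 8 < ∑ B ∈ S, f B)
    (Q : List ι → Prop) [DecidablePred Q]
    (hQ : ∀ a ∈ S, ∀ b ∈ S, ∀ r, 0 < f a → 0 < f b → Q (a :: b :: r)) :
    (#S).factorial ≤ 8 * #{O ∈ orderings S | Q O} := by
  have hpairs := card_pos_pairs_le (S := S) (p := fun B => 0 < f B) Q hQ
  have hcard := Finset.card_filter_add_card_filter_not (s := S) (fun B => 0 < f B)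
  rw [← Finset.sum_filter_add_sum_filter_not S (fun B => 0 < f B)] at hsum
  have hpos : ∑ B ∈ S with 0 < f B, f B ≤ #{B ∈ S | 0 < f B} * (8 : ℝ) := by
    rw [← nsmul_eq_mul]
    refine Finset.sum_le_card_nsmul _ _ _ fun B hB => ?_
    rw [Finset.mem_filter] at hB
    rcases hS B hB.1 with h | h
    · exact h.2
    · linarith [hB.2]
  have hneg : ∑ B ∈ S with ¬ 0 < f B, f B ≤ #{B ∈ S | ¬ 0 < f B} * (-7 : ℝ) := by
    rw [← nsmul_eq_mul]
    refine Finset.sum_le_card_nsmul _ _ _ fun B hB => ?_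
    rw [Finset.mem_filter] at hB
    rcases hS B hB.1 with h | h
    · exact absurd (by linarith [h.1]) hB.2
    · exact h
  set p := #{B ∈ S | 0 < f B} with hp
  set n := #{B ∈ S | ¬ 0 < f B} with hn
  have h1 : 7 * n + 8 < 8 * p := by
    have : (7 : ℝ) * n + 8 < 8 * p := by linarith
    exact_mod_cast this
  obtain ⟨q, hq⟩ : ∃ q, p = q + 2 := ⟨p - 2, by omega⟩
  have h2 : p * p - p = (q + 2) * (q + 1) := by
    rw [hq, Nat.sub_eq_iff_eq_add (Nat.le_mul_self _)]
    ring
  have h3 : #S = q + n + 2 := by omega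
  have h4 : (q + n + 2) * (q + n + 1) ≤ 8 * ((q + 2) * (q + 1)) := by
    have h5 : 7 * (q + n + 2) ≤ 15 * (q + 2) := by omega
    have h6 : 7 * (q + n + 1) ≤ 15 * (q + 1) := by omega
    have := Nat.mul_le_mul h5 h6
    nlinarith
  rw [h2, h3, Nat.add_sub_cancel] at hpairs
  calc (#S).factorial = (q + n + 2) * (q + n + 1) * (q + n).factorial := by
        rw [h3, Nat.factorial_succ, Nat.factorial_succ]
        ring
    _ ≤ 8 * ((q + 2) * (q + 1)) * (q + n).factorial := Nat.mul_le_mul_right _ h4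
    _ = 8 * ((q + 2) * (q + 1) * (q + n).factorial) := by ring
    _ ≤ _ := Nat.mul_le_mul_left _ hpairs

theorem factorial_le_card_two_posBlocks {s : Finset ι} (hw : ∀ i ∈ s, |w i| ≤ 1)
    (hW : 15 < ∑ i ∈ s, w i) (Q : List ι → Prop) [DecidablePred Q]
    (hQ : ∀ J L r, IsPosBlock w J → IsPosBlock w L → Q (J ++ L ++ r)) :
    (#s).factorial ≤ 8 * #{l ∈ orderings s | Q l} := by
  obtain ⟨𝒞, h𝒞, hsum⟩ := exists_configurations (w := w) (K := 7) (by norm_num) s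
  have h1 := hsum fun _ => 1
  have h2 := hsum fun l => if Q l then 1 else 0
  simp only [Finset.sum_const, nsmul_eq_mul, mul_one, card_orderings, Finset.sum_boole] at h1 h2
  have h3 : ((#s).factorial : ℝ) ≤ 8 * #{l ∈ orderings s | Q l} := by
    rw [h1, h2, Finset.mul_sum]
    refine Finset.sum_le_sum fun c hc => ?_
    have hO : c.1.toList ∈ orderings c.1 := mem_orderings.2 ⟨c.1.nodup_toList, by simp⟩
    have hmem : ∀ B ∈ c.1, ∀ i ∈ B, i ∈ s := by
      intro B hB i hi
      rw [← mem_iff_of_mem_orderings ((h𝒞 c hc).2.2 _ hO), List.mem_append, List.mem_flatten]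
      exact Or.inl ⟨B, by simpa using hB, hi⟩
    have hWc := listWeight_of_mem_orderings (w := w) ((h𝒞 c hc).2.2 _ hO)
    rw [listWeight_append, listWeight_flatten, sum_map_of_mem_orderings hO] at hWc
    have hr := abs_lt.1 ((h𝒞 c hc).2.1 _ (List.prefix_refl _))
    have hB : ∀ B ∈ c.1, 7 ≤ listWeight w B ∧ listWeight w B ≤ 8 ∨ listWeight w B ≤ -7 := by
      intro B hB
      rcases ((h𝒞 c hc).1 B hB).weight_mem (cp := 1) (cn := 1)
        fun i hi => abs_le.1 (hw i (hmem B hB i hi)) with h | h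
      · exact Or.inl ⟨h.1, by linarith⟩
      · exact Or.inr h.2
    have := factorial_le_card_of_pos_sum hB (by linarith) (fun O => Q (O.flatten ++ c.2))
      fun a ha b hb r hpa hpb => by
        rw [List.flatten_cons, List.flatten_cons, ← List.append_assoc, List.append_assoc _ _ c.2]
        exact hQ a b _ ⟨(h𝒞 c hc).1 a ha, hpa⟩ ⟨(h𝒞 c hc).1 b hb, hpb⟩
    exact_mod_cast this
  exact_mod_cast h3

end PositiveTotal

section Pairs
variable {ι : Type*} [DecidableEq ι] {w : ι → ℝ} {s : Finset ι}

open Classical in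
/-- The orderings of subsets of `s` that are positive blocks. -/
noncomputable def posBlocks (w : ι → ℝ) (s : Finset ι) : Finset (List ι) :=
  {B ∈ s.powerset.biUnion orderings | IsPosBlock w B}

open Classical in
/-- The pairs of disjoint positive blocks inside `s`. -/
noncomputable def posBlockPairs (w : ι → ℝ) (s : Finset ι) : Finset (List ι × List ι) :=
  {x ∈ posBlocks w s ×ˢ posBlocks w s | x.1.Disjoint x.2}

theorem mem_posBlocks {B : List ι} :
    B ∈ posBlocks w s ↔ B.Nodup ∧ B.toFinset ⊆ s ∧ IsPosBlock w B := by
  simp only [posBlocks, Finset.mem_filter, Finset.mem_biUnion, Finset.mem_powerset, mem_orderings]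
  constructor
  · rintro ⟨⟨t, ht, h1, rfl⟩, h2⟩
    exact ⟨h1, ht, h2⟩
  · rintro ⟨h1, h2, h3⟩
    exact ⟨⟨_, h2, h1, rfl⟩, h3⟩

theorem mem_posBlockPairs {x : List ι × List ι} :
    x ∈ posBlockPairs w s ↔ x.1 ∈ posBlocks w s ∧ x.2 ∈ posBlocks w s ∧ x.1.Disjoint x.2 := by
  simp only [posBlockPairs, Finset.mem_filter, Finset.mem_product, and_assoc]

theorem append_of_mem_posBlocks {A B : List ι} (hA : A ∈ posBlocks w s) (hB : B ∈ posBlocks w s)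
    (h : A.Disjoint B) : (A ++ B).Nodup ∧ (A ++ B).toFinset ⊆ s := by
  rw [mem_posBlocks] at hA hB
  rw [List.toFinset_append]
  exact ⟨hA.1.append hB.1 h, Finset.union_subset hA.2.1 hB.2.1⟩

theorem card_sdiff_posBlockPair {x : List ι × List ι} (hx : x ∈ posBlockPairs w s) :
    #(s \ (x.1 ++ x.2).toFinset) = #s - (x.1.length + x.2.length) ∧
      x.1.length + x.2.length ≤ #s := by
  obtain ⟨h1, h2, h3⟩ := mem_posBlockPairs.1 hx
  obtain ⟨h4, h5⟩ := append_of_mem_posBlocks h1 h2 h3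
  rw [Finset.card_sdiff_of_subset h5, List.toFinset_card_of_nodup h4, List.length_append]
  have := Finset.card_le_card h5
  rw [List.toFinset_card_of_nodup h4, List.length_append] at this
  exact ⟨rfl, this⟩

theorem factorial_le_sum_posBlockPairs (hw : ∀ i ∈ s, |w i| ≤ 1) (hW : 15 < ∑ i ∈ s, w i) :
    (#s).factorial ≤
      8 * ∑ x ∈ posBlockPairs w s, (#s - (x.1.length + x.2.length)).factorial := by
  classical
  refine (factorial_le_card_two_posBlocks hw hW
    (fun l => ∃ J L r, IsPosBlock w J ∧ IsPosBlock w L ∧ l = J ++ L ++ r)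
    fun J L r hJ hL => ⟨J, L, r, hJ, hL, rfl⟩).trans (Nat.mul_le_mul_left _ ?_)
  have h1 : ∑ x ∈ posBlockPairs w s, (#s - (x.1.length + x.2.length)).factorial =
      ∑ x ∈ posBlockPairs w s, #(orderings (s \ (x.1 ++ x.2).toFinset)) := by
    refine Finset.sum_congr rfl fun x hx => ?_
    rw [card_orderings, (card_sdiff_posBlockPair hx).1]
  rw [h1, ← Finset.card_sigma]
  refine Finset.card_le_card_of_surjOn (fun y => y.1.1 ++ y.1.2 ++ y.2) ?_
  intro l hl
  rw [Finset.mem_coe, Finset.mem_filter] at hl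
  obtain ⟨hl, J, L, r, hJ, hL, rfl⟩ := hl
  obtain ⟨h2, h3⟩ := mem_orderings.1 hl
  have hr : r ∈ orderings (s \ (J ++ L).toFinset) := by
    have := (take_drop_mem_orderings (k := (J ++ L).length) hl rfl).2
    rwa [List.drop_left, List.take_left] at this
  have hmem : ∀ B : List ι, B ⊆ J ++ L ++ r → B.toFinset ⊆ s := by
    intro B hB i hi
    rw [← h3, List.mem_toFinset]
    exact hB (List.mem_toFinset.1 hi)
  have h4 := List.nodup_append'.1 (List.nodup_append'.1 h2).1
  refine ⟨⟨(J, L), r⟩, ?_, rfl⟩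
  rw [Finset.mem_coe, Finset.mem_sigma, mem_posBlockPairs, mem_posBlocks, mem_posBlocks]
  refine ⟨⟨⟨h4.1, hmem _ ?_, hJ⟩, ⟨h4.2.1, hmem _ ?_, hL⟩, h4.2.2⟩, hr⟩
  · intro i hi
    simp [hi]
  · intro i hi
    simp [hi]

theorem sum_factorial_le_of_drop_take_eq {X : Type*} {T : Finset X} {J L : X → List ι}
    {U : Finset ι} {i k : ℕ} (hT : ∀ x ∈ T, (J x, L x) ∈ posBlockPairs w s)
    (hinj : ∀ x ∈ T, ∀ y ∈ T, J x = J y → L x = L y → x = y) (hik : i + k ≤ #s)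
    (hU : ∀ x ∈ T, i + k ≤ (J x).length ∧ (((J x).drop i).take k).toFinset = U) :
    ∑ x ∈ T, (#s - ((J x).length + (L x).length)).factorial ≤
      k.factorial * (#s - k).factorial := by
  refine le_trans ?_ (card_drop_take_eq_le (U := U) hik)
  simp only [← List.length_append]
  have hT' := fun x hx => mem_posBlockPairs.1 (hT x hx)
  refine sum_factorial_le_of_prefix_free (h := fun x => J x ++ L x) ?_ ?_ _ ?_
  · exact fun x hx => append_of_mem_posBlocks (hT' x hx).1 (hT' x hx).2.1 (hT' x hx).2.2
  · intro l x hx y hy h h'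
    have := (mem_posBlocks.1 (hT' x hx).1).2.2.1.pair_eq_of_prefix
      (mem_posBlocks.1 (hT' x hx).2.1).2.2.1 (mem_posBlocks.1 (hT' y hy).1).2.2.1
      (mem_posBlocks.1 (hT' y hy).2.1).2.2.1 h h'
    exact hinj x hx y hy this.1 this.2
  · intro x hx r
    have := (hU x hx).1
    rw [List.append_assoc, List.drop_append_of_le_length (by omega),
      List.take_append_of_le_length (by rw [List.length_drop]; omega)]
    exact (hU x hx).2

theorem sum_factorial_posBlocks_le (w : ι → ℝ) (s : Finset ι) :
    ∑ B ∈ posBlocks w s, (#s - B.length).factorial ≤ (#s).factorial := by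
  have := sum_factorial_le_of_prefix_free (s := s) (T := posBlocks w s) (h := id)
    (fun B hB => ⟨(mem_posBlocks.1 hB).1, (mem_posBlocks.1 hB).2.1⟩)
    (fun l A hA B hB h h' => (mem_posBlocks.1 hA).2.2.1.eq_of_prefix_of_prefix
      (mem_posBlocks.1 hB).2.2.1 h h') (fun _ => True) (fun _ _ _ => trivial)
  rwa [Finset.filter_true, card_orderings] at this

theorem sum_factorial_mul_factorial_le {U : Finset ι} (hU : U ⊆ s) :
    ∑ x ∈ posBlockPairs w s with x.1.toFinset ⊆ U ∧ x.2.toFinset ⊆ s \ U,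
      (#U - x.1.length).factorial * (#s - #U - x.2.length).factorial ≤
        (#U).factorial * (#s - #U).factorial := by
  have hc : #(s \ U) = #s - #U := Finset.card_sdiff_of_subset hU
  calc _ ≤ ∑ x ∈ posBlocks w U ×ˢ posBlocks w (s \ U),
        (#U - x.1.length).factorial * (#s - #U - x.2.length).factorial := by
        refine Finset.sum_le_sum_of_subset fun x hx => ?_
        rw [Finset.mem_filter, mem_posBlockPairs, mem_posBlocks, mem_posBlocks] at hx
        rw [Finset.mem_product, mem_posBlocks, mem_posBlocks]
        exact ⟨⟨hx.1.1.1, hx.2.1, hx.1.1.2.2⟩, hx.1.2.1.1, hx.2.2, hx.1.2.1.2.2⟩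
    _ = (∑ A ∈ posBlocks w U, (#U - A.length).factorial) *
        ∑ B ∈ posBlocks w (s \ U), (#(s \ U) - B.length).factorial := by
        rw [Finset.sum_mul_sum, Finset.sum_product, hc]
    _ ≤ _ := by
        rw [← hc]
        exact Nat.mul_le_mul (sum_factorial_posBlocks_le w U) (sum_factorial_posBlocks_le w _)

end Pairs

section Insertion
variable {ι : Type*} [DecidableEq ι] {w : ι → ℝ} {s : Finset ι}

theorem toFinset_drop_eq_sdiff {U : Finset ι} {l : List ι} {k : ℕ} (hl : l ∈ orderings s)
    (hU : (l.take k).toFinset = U) : (l.drop k).toFinset = s \ U :=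
  (mem_orderings.1 (take_drop_mem_orderings hl hU).2).2

theorem append_append_mem_orderings {J L J' L' r : List ι} (hx : (J, L) ∈ posBlockPairs w s)
    (hJ : J'.Perm J) (hL : L'.Perm L) (hr : r ∈ orderings (s \ (J ++ L).toFinset)) :
    J' ++ r ++ L'.reverse ∈ orderings s := by
  obtain ⟨h1, h2, h3⟩ := mem_posBlockPairs.1 hx
  obtain ⟨h4, h5⟩ := append_of_mem_posBlocks h1 h2 h3
  have h6 := append_mem_orderings (mem_orderings_self h4) hr Finset.disjoint_sdiff
  rw [Finset.union_sdiff_of_subset h5] at h6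
  refine mem_orderings_of_perm h6 ?_
  rw [List.append_assoc, List.append_assoc]
  exact hJ.append (List.perm_append_comm.trans (((List.reverse_perm L').trans hL).append_right r))

theorem sum_insertion_le {J L J' L' : List ι} {ν : List ι → ℝ} {α : ℝ} {k : ℕ} {U : Finset ι}
    (hx : (J, L) ∈ posBlockPairs w s) (hJ : J'.Perm J) (hL : L'.Perm L)
    (hJ' : ∀ k ≤ J.length, ∃ i, i + k ≤ J.length ∧ (J'.take k).Perm ((J.drop i).take k))
    (hL' : ∀ k ≤ L.length, ∃ i, i + k ≤ L.length ∧ (L'.take k).Perm ((L.drop i).take k))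
    (hα : 0 ≤ α) (hν : IsAlmostUniform (s \ (J ++ L).toFinset) α ν) (hk : k ≤ #s) :
    ((#s - (J.length + L.length)).factorial : ℝ) *
      ∑ r ∈ orderings (s \ (J ++ L).toFinset) with
        ((J' ++ r ++ L'.reverse).take k).toFinset = U, ν r ≤
    (∑ i ∈ Finset.range (#s - k + 1),
      if i + k ≤ J.length ∧ ((J.drop i).take k).toFinset = U
        then ((#s - (J.length + L.length)).factorial : ℝ) else 0) +
    (∑ i ∈ Finset.range (k + 1),
      if i + (#s - k) ≤ L.length ∧ ((L.drop i).take (#s - k)).toFinset = s \ U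
        then ((#s - (J.length + L.length)).factorial : ℝ) else 0) +
    if J.toFinset ⊆ U ∧ L.toFinset ⊆ s \ U then
      α * ((k - J.length).factorial * (#s - k - L.length).factorial) else 0 := by
  obtain ⟨hcard, hle⟩ := card_sdiff_posBlockPair hx
  obtain ⟨hν0, hν1, hνk⟩ := hν
  dsimp only at hcard hle
  rw [hcard] at hνk
  set N : ℝ := ((#s - (J.length + L.length)).factorial : ℝ) with hN
  have hN0 : 0 ≤ N := by positivity
  have hA : 0 ≤ ∑ i ∈ Finset.range (#s - k + 1),
      if i + k ≤ J.length ∧ ((J.drop i).take k).toFinset = U then N else 0 :=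
    Finset.sum_nonneg fun i _ => by positivity
  have hB : 0 ≤ ∑ i ∈ Finset.range (k + 1),
      if i + (#s - k) ≤ L.length ∧ ((L.drop i).take (#s - k)).toFinset = s \ U
        then N else 0 :=
    Finset.sum_nonneg fun i _ => by positivity
  have hC : 0 ≤ if J.toFinset ⊆ U ∧ L.toFinset ⊆ s \ U then
      α * (((k - J.length).factorial : ℝ) * (#s - k - L.length).factorial) else 0 := by
    positivity
  rcases Finset.eq_empty_or_nonempty {r ∈ orderings (s \ (J ++ L).toFinset) |
    ((J' ++ r ++ L'.reverse).take k).toFinset = U} with he | ⟨r₀, hr₀⟩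
  · rw [he, Finset.sum_empty, mul_zero]
    positivity
  rw [Finset.mem_filter] at hr₀
  obtain ⟨hr₀, hr₀U⟩ := hr₀
  have hmem := fun r hr => append_append_mem_orderings (r := r) hx hJ hL hr
  have hsum : N * ∑ r ∈ orderings (s \ (J ++ L).toFinset) with
      ((J' ++ r ++ L'.reverse).take k).toFinset = U, ν r ≤ N := by
    refine mul_le_of_le_one_right hN0 (hν1 ▸ ?_)
    exact Finset.sum_le_sum_of_subset_of_nonneg (Finset.filter_subset _ _) fun l _ _ => hν0 l
  have hlenJ := hJ.length_eq
  have hlenL := hL.length_eq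
  have hlenr := fun r (hr : r ∈ orderings (s \ (J ++ L).toFinset)) => length_of_mem_orderings hr
  rw [hcard] at hlenr
  rcases le_or_gt k J.length with hkJ | hkJ
  · obtain ⟨i, hi, hperm⟩ := hJ' k hkJ
    have h1 : ((J.drop i).take k).toFinset = U := by
      rw [← hr₀U, List.append_assoc, List.take_append_of_le_length (by omega),
        List.toFinset_eq_of_perm _ _ hperm]
    have h2 := Finset.single_le_sum (f := fun i =>
      if i + k ≤ J.length ∧ ((J.drop i).take k).toFinset = U then N else 0)
      (fun i _ => by positivity) (by rw [Finset.mem_range]; omega : i ∈ Finset.range (#s - k + 1))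
    rw [if_pos ⟨hi, h1⟩] at h2
    linarith
  rcases le_or_gt (#s - k) L.length with hkL | hkL
  · obtain ⟨i, hi, hperm⟩ := hL' _ hkL
    have h1 : ((L.drop i).take (#s - k)).toFinset = s \ U := by
      have h3 := hlenr r₀ hr₀
      rw [← toFinset_drop_eq_sdiff (hmem r₀ hr₀) hr₀U, List.drop_append,
        List.drop_of_length_le (l := J' ++ r₀) (by rw [List.length_append]; omega),
        List.nil_append,
        List.drop_reverse, List.toFinset_reverse, ← List.toFinset_eq_of_perm _ _ hperm]
      congr 2
      rw [List.length_append]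
      omega
    have h2 := Finset.single_le_sum (f := fun i =>
      if i + (#s - k) ≤ L.length ∧ ((L.drop i).take (#s - k)).toFinset = s \ U then N else 0)
      (fun i _ => by positivity) (by rw [Finset.mem_range]; omega : i ∈ Finset.range (k + 1))
    rw [if_pos ⟨hi, h1⟩] at h2
    linarith
  · have htake : ∀ r ∈ orderings (s \ (J ++ L).toFinset),
        (J' ++ r ++ L'.reverse).take k = J' ++ r.take (k - J.length) := by
      intro r hr
      have h3 := hlenr r hr
      rw [List.append_assoc, List.take_append, List.take_of_length_le (by omega), hlenJ,
        List.take_append_of_le_length (by omega)]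
    have hJU : J.toFinset ⊆ U := by
      rw [← hr₀U, htake r₀ hr₀, List.toFinset_append, List.toFinset_eq_of_perm _ _ hJ]
      exact Finset.subset_union_left
    have hLU : L.toFinset ⊆ s \ U := by
      have h3 := hlenr r₀ hr₀
      rw [← toFinset_drop_eq_sdiff (hmem r₀ hr₀) hr₀U,
        List.drop_append_of_le_length (by rw [List.length_append]; omega), List.toFinset_append,
        List.toFinset_reverse, List.toFinset_eq_of_perm _ _ hL]
      exact Finset.subset_union_right
    rw [if_pos ⟨hJU, hLU⟩]
    have h4 := hνk (k - J.length) (by omega) (U \ J.toFinset)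
    have h5 : #s - (J.length + L.length) - (k - J.length) = #s - k - L.length := by omega
    rw [h5] at h4
    refine le_trans (le_trans (mul_le_mul_of_nonneg_left ?_ hN0) h4) (by linarith)
    refine Finset.sum_le_sum_of_subset_of_nonneg ?_ fun l _ _ => hν0 l
    intro r hr
    rw [Finset.mem_filter] at hr ⊢
    refine ⟨hr.1, ?_⟩
    rw [← hr.2, htake r hr.1, List.toFinset_append, List.toFinset_eq_of_perm _ _ hJ,
      Finset.union_sdiff_cancel_left]
    rw [Finset.disjoint_left]
    intro a ha hb
    have h6 := (mem_iff_of_mem_orderings hr.1).1 (List.mem_of_mem_take (List.mem_toFinset.1 hb))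
    rw [Finset.mem_sdiff, List.toFinset_append] at h6
    exact h6.2 (Finset.mem_union_left _ ha)

omit [DecidableEq ι] in
theorem listWeight_take_eq_sub (l : List ι) (k : ℕ) :
    listWeight w (l.take k) = listWeight w l - listWeight w (l.drop k) := by
  conv_rhs => rw [← List.take_append_drop k l, listWeight_append, List.take_append_drop]
  ring

omit [DecidableEq ι] in
theorem listWeight_take_insertion_mem {J L r : List ι} {W : ℝ} (hW : 15 < W)
    (hJL : listWeight w (J ++ r ++ L.reverse) = W)
    (hJ : listWeight w J ∈ Set.Icc 7 8) (hL : listWeight w L ∈ Set.Icc 7 8)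
    (hJ' : ∀ k, listWeight w (J.take k) ∈ Set.Icc 0 15)
    (hL' : ∀ k, listWeight w (L.take k) ∈ Set.Icc 0 15)
    (hr : ∀ k, listWeight w (r.take k) ∈
      Set.Icc (min (listWeight w r) 0 - 7) (max (listWeight w r) 0 + 7)) (k : ℕ) :
    listWeight w ((J ++ r ++ L.reverse).take k) ∈ Set.Icc 0 W := by
  simp only [Set.mem_Icc] at *
  have hsum := hJL
  rw [listWeight_append, listWeight_append, listWeight_reverse] at hsum
  rcases le_total k J.length with hkJ | hkJ
  · rw [List.append_assoc, List.take_append_of_le_length hkJ]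
    exact ⟨(hJ' k).1, (hJ' k).2.trans hW.le⟩
  rcases le_total k (J ++ r).length with hkr | hkr
  · rw [List.take_append_of_le_length hkr, List.take_append, List.take_of_length_le hkJ,
      listWeight_append]
    have h1 := hr (k - J.length)
    rcases le_total (listWeight w r) 0 with h0 | h0
    · rw [min_eq_left h0, max_eq_right h0] at h1
      constructor <;> linarith
    · rw [min_eq_right h0, max_eq_left h0] at h1
      constructor <;> linarith
  · rw [listWeight_take_eq_sub, hJL, List.drop_append, List.drop_of_length_le hkr,
      List.nil_append, List.drop_reverse, listWeight_reverse]
    have h1 := hL' (L.length - (k - (J ++ r).length))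
    constructor <;> linarith

theorem IsAlmostUniform.mono {a b : ℝ} {ν : List ι → ℝ} (h : IsAlmostUniform s a ν)
    (hab : a ≤ b) : IsAlmostUniform s b ν :=
  ⟨h.1, h.2.1, fun k hk U => (h.2.2 k hk U).trans (by gcongr)⟩

theorem exists_isAlmostUniform_mem_Icc (hw : ∀ i ∈ s, |w i| ≤ 1) (hW : 15 < ∑ i ∈ s, w i) :
    ∃ ν, IsAlmostUniform s (8 * (2 * (2 * (600 * Real.exp 48 * ((#s : ℝ) ^ 2 + 1))))) ν ∧
      ∀ l ∈ orderings s, 0 < ν l → ∀ k, listWeight w (l.take k) ∈ Set.Icc 0 (∑ i ∈ s, w i) := by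
  set α := 2 * (600 * Real.exp 48 * ((#s : ℝ) ^ 2 + 1)) with hα
  have hα0 : 0 ≤ α := by positivity
  have hws : ∀ B ∈ posBlocks w s, ∀ i ∈ B, |w i| ≤ 1 := fun B hB i hi =>
    hw i ((mem_posBlocks.1 hB).2.1 (List.mem_toFinset.2 hi))
  have hrot : ∀ B : List ι, B ∈ posBlocks w s → _ := fun B hB =>
    (mem_posBlocks.1 hB).2.2.exists_rotation (hws B hB)
  choose! R hRperm hRmem hRset using hrot
  have hmid : ∀ x : List ι × List ι, ∃ ν, IsAlmostUniform (s \ (x.1 ++ x.2).toFinset) α ν ∧ _ :=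
    fun x => by
      obtain ⟨ν, h1, h2⟩ := exists_isAlmostUniform_balanced (s \ (x.1 ++ x.2).toFinset)
        fun i hi => hw i (Finset.mem_sdiff.1 hi).1
      refine ⟨ν, h1.mono ?_, h2⟩
      have : #(s \ (x.1 ++ x.2).toFinset) ≤ #s := Finset.card_le_card Finset.sdiff_subset
      rw [hα]
      gcongr
  choose ν hν hνmem using hmid
  set N : List ι × List ι → ℝ := fun x => (#s - (x.1.length + x.2.length)).factorial with hN
  have hN0 : ∀ x, 0 < N x := fun x => by positivity
  have hmem : ∀ x ∈ posBlockPairs w s, ∀ r ∈ orderings (s \ (x.1 ++ x.2).toFinset),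
      R x.1 ++ r ++ (R x.2).reverse ∈ orderings s := fun x hx r hr =>
    append_append_mem_orderings hx (hRperm _ (mem_posBlockPairs.1 hx).1)
      (hRperm _ (mem_posBlockPairs.1 hx).2.1) hr
  have huni := exists_isAlmostUniform (s := s) (b := 8) (a := 2 * α)
    (D := (posBlockPairs w s).sigma fun x => orderings (s \ (x.1 ++ x.2).toFinset))
    (c := fun y => N y.1 * ν y.1 y.2) (g := fun y => R y.1.1 ++ y.2 ++ (R y.1.2).reverse)
    ?_ ?_ ?_ ?_
  · obtain ⟨ν', h1, h2⟩ := huni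
    refine ⟨ν', h1, fun l _ hl k => ?_⟩
    obtain ⟨⟨x, r⟩, hy, hpos, rfl⟩ := h2 l hl
    obtain ⟨hx, hr⟩ := Finset.mem_sigma.1 hy
    obtain ⟨hxJ, hxL, -⟩ := mem_posBlockPairs.1 hx
    dsimp only at hpos hr hxJ hxL hx ⊢
    have hrν := pos_of_mul_pos_right hpos (hN0 x).le
    refine listWeight_take_insertion_mem hW (listWeight_of_mem_orderings (hmem x hx r hr)) ?_ ?_
      (hRmem _ hxJ) (hRmem _ hxL) (fun k => ?_) k
    · rw [listWeight_perm (hRperm _ hxJ)]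
      exact (mem_posBlocks.1 hxJ).2.2.weight_mem (hws _ hxJ)
    · rw [listWeight_perm (hRperm _ hxL)]
      exact (mem_posBlocks.1 hxL).2.2.weight_mem (hws _ hxL)
    · rw [listWeight_of_mem_orderings hr]
      exact hνmem x r hrν k
  · rintro ⟨x, r⟩ hy
    obtain ⟨hx, hr⟩ := Finset.mem_sigma.1 hy
    exact hmem x hx r hr
  · rintro ⟨x, r⟩ -
    exact mul_nonneg (hN0 x).le ((hν x).1 r)
  · have h1 := factorial_le_sum_posBlockPairs hw hW
    rw [Finset.sum_sigma]
    dsimp only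
    simp only [← Finset.mul_sum, (hν _).2.1, mul_one, hN]
    exact_mod_cast h1
  · intro k hk U
    by_cases hU : U ⊆ s ∧ #U = k
    swap
    · rw [Finset.filter_false_of_mem, Finset.sum_empty]
      · positivity
      · rintro ⟨x, r⟩ hy h
        obtain ⟨hx, hr⟩ := Finset.mem_sigma.1 hy
        have h1 := hmem x hx r hr
        refine hU ⟨h ▸ toFinset_take_subset h1 k, ?_⟩
        rw [← length_of_mem_orderings (take_drop_mem_orderings h1 h).1, List.length_take,
          length_of_mem_orderings h1, min_eq_left hk]
    obtain ⟨hUs, rfl⟩ := hU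
    set k := #U with hkdef
    set F : ℝ := (k.factorial : ℝ) * (#s - k).factorial with hF
    have hA : ∑ x ∈ posBlockPairs w s, ∑ i ∈ Finset.range (#s - k + 1),
        (if i + k ≤ x.1.length ∧ ((x.1.drop i).take k).toFinset = U then N x else 0) ≤
          (#s - k + 1 : ℕ) * F := by
      rw [Finset.sum_comm]
      refine (Finset.sum_le_card_nsmul (Finset.range (#s - k + 1)) _ F fun i hi => ?_).trans_eq
        (by rw [Finset.card_range, nsmul_eq_mul])
      rw [Finset.mem_range] at hi
      rw [← Finset.sum_filter]
      have := sum_factorial_le_of_drop_take_eq (w := w) (s := s) (i := i) (k := k) (U := U)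
        (T := {x ∈ posBlockPairs w s | i + k ≤ x.1.length ∧ ((x.1.drop i).take k).toFinset = U})
        (J := Prod.fst) (L := Prod.snd) (fun x hx => (Finset.mem_filter.1 hx).1)
        (fun x _ y _ => Prod.ext) (by omega) (fun x hx => (Finset.mem_filter.1 hx).2)
      simp only [hN, hF]
      exact_mod_cast this
    have hB : ∑ x ∈ posBlockPairs w s, ∑ i ∈ Finset.range (k + 1),
        (if i + (#s - k) ≤ x.2.length ∧ ((x.2.drop i).take (#s - k)).toFinset = s \ U
          then N x else 0) ≤ (k + 1 : ℕ) * F := by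
      rw [Finset.sum_comm]
      refine (Finset.sum_le_card_nsmul (Finset.range (k + 1)) _ F fun i hi => ?_).trans_eq
        (by rw [Finset.card_range, nsmul_eq_mul])
      rw [Finset.mem_range] at hi
      rw [← Finset.sum_filter]
      have := sum_factorial_le_of_drop_take_eq (w := w) (s := s) (i := i) (k := #s - k)
        (U := s \ U) (T := {x ∈ posBlockPairs w s |
          i + (#s - k) ≤ x.2.length ∧ ((x.2.drop i).take (#s - k)).toFinset = s \ U})
        (J := Prod.snd) (L := Prod.fst)
        (fun x hx => by
          have := mem_posBlockPairs.1 (Finset.mem_filter.1 hx).1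
          exact mem_posBlockPairs.2 ⟨this.2.1, this.1, this.2.2.symm⟩)
        (fun x _ y _ h1 h2 => Prod.ext h2 h1) (by omega) (fun x hx => (Finset.mem_filter.1 hx).2)
      rw [Nat.sub_sub_self hk, mul_comm (#s - k).factorial] at this
      simp only [add_comm (List.length (Prod.snd _))] at this
      simp only [hN, hF]
      exact_mod_cast this
    have hC : ∑ x ∈ posBlockPairs w s, (if x.1.toFinset ⊆ U ∧ x.2.toFinset ⊆ s \ U then
        α * (((k - x.1.length).factorial : ℝ) * (#s - k - x.2.length).factorial) else 0) ≤
          α * F := by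
      rw [← Finset.sum_filter, ← Finset.mul_sum]
      have := sum_factorial_mul_factorial_le (w := w) hUs
      refine mul_le_mul_of_nonneg_left ?_ hα0
      rw [hF]
      exact_mod_cast this
    calc _ = ∑ x ∈ posBlockPairs w s, N x * ∑ r ∈ orderings (s \ (x.1 ++ x.2).toFinset) with
          ((R x.1 ++ r ++ (R x.2).reverse).take k).toFinset = U, ν x r := by
          rw [Finset.sum_filter, Finset.sum_sigma]
          refine Finset.sum_congr rfl fun x _ => ?_
          dsimp only
          rw [← Finset.sum_filter, Finset.mul_sum]
      _ ≤ (#s - k + 1 : ℕ) * F + (k + 1 : ℕ) * F + α * F := by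
          refine le_trans ?_ (add_le_add (add_le_add hA hB) hC)
          rw [← Finset.sum_add_distrib, ← Finset.sum_add_distrib]
          refine Finset.sum_le_sum fun x hx => ?_
          obtain ⟨hxJ, hxL, -⟩ := mem_posBlockPairs.1 hx
          exact sum_insertion_le hx (hRperm _ hxJ) (hRperm _ hxL) (hRset _ hxJ) (hRset _ hxL)
            hα0 (hν x) hk
      _ = ((#s : ℝ) + 2) * F + α * F := by
          rw [← add_mul, ← Nat.cast_add, show #s - k + 1 + (k + 1) = #s + 2 by omega]
          push_cast
          ring
      _ ≤ α * F + α * F := by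
          gcongr
          have h1 : 1 ≤ Real.exp 48 := Real.one_le_exp (by norm_num)
          rw [hα]
          nlinarith [sq_nonneg ((#s : ℝ) - 1), mul_nonneg (sub_nonneg.2 h1) (sq_nonneg (#s : ℝ))]
      _ = _ := by ring

end Insertion

section Permutations
variable {m : ℕ}

theorem take_ofFn_perm (σ : Equiv.Perm (Fin m)) (k : ℕ) :
    ((List.ofFn σ).take k).Perm
      (((Finset.univ.filter fun i : Fin m => (i : ℕ) < k).toList).map σ) := by
  have h : ((List.finRange m).take k).Perm
      (Finset.univ.filter fun i : Fin m => (i : ℕ) < k).toList := by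
    rw [List.perm_ext_iff_of_nodup ((List.nodup_finRange m).sublist (List.take_sublist _ _))
      (Finset.nodup_toList _)]
    intro i
    rw [Finset.mem_toList, Finset.mem_filter, List.mem_take_iff_getElem]
    constructor
    · rintro ⟨j, hj, rfl⟩
      rw [List.length_finRange] at hj
      simp
      omega
    · rintro ⟨-, hi⟩
      exact ⟨i, by simpa using hi, by simp⟩
  rw [List.ofFn_eq_map, ← List.map_take]
  exact h.map σ

theorem toFinset_take_ofFn (σ : Equiv.Perm (Fin m)) (k : ℕ) :
    ((List.ofFn σ).take k).toFinset =
      (Finset.univ.filter fun i : Fin m => (i : ℕ) < k).image σ := by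
  ext i
  rw [List.toFinset_eq_of_perm _ _ (take_ofFn_perm σ k)]
  simp

theorem listWeight_take_ofFn (w : Fin m → ℝ) (σ : Equiv.Perm (Fin m)) (k : ℕ) :
    listWeight w ((List.ofFn σ).take k) =
      ∑ i ∈ Finset.univ.filter (fun i : Fin m => (i : ℕ) < k), w (σ i) := by
  rw [listWeight_perm (take_ofFn_perm σ k), listWeight, List.map_map, Finset.sum_map_toList]
  rfl

theorem ofFn_mem_orderings (σ : Equiv.Perm (Fin m)) :
    List.ofFn σ ∈ orderings (Finset.univ : Finset (Fin m)) := by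
  rw [mem_orderings, List.nodup_ofFn]
  refine ⟨σ.injective, ?_⟩
  ext i
  simpa [List.mem_ofFn] using σ.surjective i

theorem exists_ofFn_eq_of_mem_orderings {l : List (Fin m)}
    (hl : l ∈ orderings (Finset.univ : Finset (Fin m))) :
    ∃ σ : Equiv.Perm (Fin m), List.ofFn σ = l := by
  have hlen : l.length = m := by
    rw [length_of_mem_orderings hl, Finset.card_univ, Fintype.card_fin]
  have hinj : Function.Injective fun i : Fin m => l[(i : ℕ)]'(i.2.trans_eq hlen.symm) :=
    fun i j h => Fin.ext (((mem_orderings.1 hl).1.getElem_inj_iff).1 h)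
  refine ⟨Equiv.ofBijective _ (Finite.injective_iff_bijective.1 hinj), ?_⟩
  refine List.ext_getElem (by rw [List.length_ofFn, hlen]) fun i _ _ => ?_
  rw [List.getElem_ofFn]
  rfl

theorem sum_orderings_univ (p : List (Fin m) → Prop) [DecidablePred p] (f : List (Fin m) → ℝ) :
    ∑ l ∈ orderings (Finset.univ : Finset (Fin m)) with p l, f l =
      ∑ σ ∈ Finset.univ.filter (fun σ : Equiv.Perm (Fin m) => p (List.ofFn σ)),
        f (List.ofFn σ) := by
  symm
  refine Finset.sum_bij (fun σ _ => List.ofFn σ) (fun σ hσ => ?_) (fun σ _ τ _ h => ?_)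
    (fun l hl => ?_) fun _ _ => rfl
  · rw [Finset.mem_filter] at hσ ⊢
    exact ⟨ofFn_mem_orderings σ, hσ.2⟩
  · exact DFunLike.coe_injective (List.ofFn_injective h)
  · rw [Finset.mem_filter] at hl
    obtain ⟨σ, rfl⟩ := exists_ofFn_eq_of_mem_orderings hl.1
    exact ⟨σ, by simpa using hl.2, rfl⟩

theorem IsAlmostUniform.isRandomPerm {a : ℝ} {ν : List (Fin m) → ℝ}
    (h : IsAlmostUniform Finset.univ a ν) : IsRandomPerm fun σ => ν (List.ofFn σ) := by
  refine ⟨fun σ => h.1 _, ?_⟩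
  have := sum_orderings_univ (fun _ => True) ν
  rw [Finset.filter_true, Finset.filter_true] at this
  rw [← this, h.2.1]

theorem IsAlmostUniform.isAlphaUniform {a : ℝ} {ν : List (Fin m) → ℝ}
    (h : IsAlmostUniform Finset.univ a ν) : IsAlphaUniform a fun σ => ν (List.ofFn σ) := by
  intro k _ hk U _
  have h1 := h.2.2 k (by rwa [Finset.card_univ, Fintype.card_fin]) U
  rw [sum_orderings_univ, Finset.card_univ, Fintype.card_fin] at h1
  simp only [toFinset_take_ofFn] at h1
  rw [Nat.cast_choose ℝ hk, inv_div, ← mul_div_assoc, le_div_iff₀ (by positivity), mul_comm]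
  exact h1

theorem abs_le_maxAbsWeight (w : Fin m → ℝ) (i : Fin m) : |w i| ≤ maxAbsWeight w :=
  le_csSup ((Set.finite_range fun i => |w i|).subset (by rintro _ ⟨i, rfl⟩; exact ⟨i, rfl⟩)).bddAbove
    ⟨i, rfl⟩

theorem listWeight_div {ι : Type*} (w : ι → ℝ) (c : ℝ) (l : List ι) :
    listWeight (fun i => w i / c) l = listWeight w l / c := by
  simp only [listWeight, div_eq_mul_inv, List.sum_map_mul_right]

end Permutations

/-- Existence of balanced almost uniform permutations: there is a
universal constant `C` such that for all weights there is a `C·m²`-uniform random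
permutation that is almost surely `7`-balanced, and, if `|W| > 15 max_i |w_i|`, one
that is almost surely `0`-balanced. -/
theorem balanced_almost_uniform_permutations :
    ∃ C : ℝ, 0 < C ∧ ∀ (m : ℕ), 1 ≤ m → ∀ w : Fin m → ℝ,
      (∃ μ : Equiv.Perm (Fin m) → ℝ, IsRandomPerm μ ∧
        IsAlphaUniform (C * (m : ℝ) ^ 2) μ ∧ ∀ σ, 0 < μ σ → IsBalanced w 7 σ) ∧
      (|∑ i, w i| > 15 * maxAbsWeight w →
        ∃ μ : Equiv.Perm (Fin m) → ℝ, IsRandomPerm μ ∧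
          IsAlphaUniform (C * (m : ℝ) ^ 2) μ ∧ ∀ σ, 0 < μ σ → IsBalanced w 0 σ) := by
  refine ⟨38400 * Real.exp 48, by positivity, fun m hm w => ?_⟩
  have hm1 : (1 : ℝ) ≤ (m : ℝ) ^ 2 := one_le_pow₀ (by exact_mod_cast hm)
  have hcard : #(Finset.univ : Finset (Fin m)) = m := by rw [Finset.card_univ, Fintype.card_fin]
  have hE : 0 < Real.exp 48 := Real.exp_pos _
  have hM := abs_le_maxAbsWeight w
  set M := maxAbsWeight w with hMdef
  have hM0 : 0 ≤ M := (abs_nonneg _).trans (hM ⟨0, hm⟩)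
  rcases hM0.eq_or_lt with hM0 | hM0
  · have hw : ∀ i, w i = 0 := fun i => abs_nonpos_iff.1 (hM0 ▸ hM i)
    refine ⟨?_, fun h => absurd h (by simp [hw, ← hM0])⟩
    obtain ⟨ν, h1, -⟩ := exists_isAlmostUniform_balanced (w := w) Finset.univ
      fun i _ => by simp [hw i]
    rw [hcard] at h1
    have h2 := h1.mono (b := 38400 * Real.exp 48 * (m : ℝ) ^ 2) (by nlinarith)
    exact ⟨_, h2.isRandomPerm, h2.isAlphaUniform, fun σ _ k _ _ => by
      rw [← hMdef, ← hM0]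
      simp [hw]⟩
  have hdiv : ∀ i ∈ (Finset.univ : Finset (Fin m)), |w i / M| ≤ 1 := fun i _ => by
    rw [abs_div, abs_of_pos hM0, div_le_one hM0]
    exact hM i
  constructor
  · obtain ⟨ν, h1, h3⟩ := exists_isAlmostUniform_balanced Finset.univ hdiv
    rw [hcard] at h1
    have h2 := h1.mono (b := 38400 * Real.exp 48 * (m : ℝ) ^ 2) (by nlinarith)
    refine ⟨_, h2.isRandomPerm, h2.isAlphaUniform, fun σ hσ k _ _ => ?_⟩
    have h4 := h3 _ hσ k
    rw [listWeight_div, listWeight_take_ofFn, ← Finset.sum_div, Set.mem_Icc,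
      le_div_iff₀ hM0, div_le_iff₀ hM0, sub_mul, add_mul, min_mul_of_nonneg _ _ hM0.le,
      max_mul_of_nonneg _ _ hM0.le, zero_mul, div_mul_cancel₀ _ hM0.ne'] at h4
    exact_mod_cast h4
  · have key : ∀ c : ℝ, (∀ i ∈ (Finset.univ : Finset (Fin m)), |w i / c| ≤ 1) →
        15 < (∑ i, w i) / c → ∃ μ : Equiv.Perm (Fin m) → ℝ, IsRandomPerm μ ∧
          IsAlphaUniform (38400 * Real.exp 48 * (m : ℝ) ^ 2) μ ∧ ∀ σ, 0 < μ σ → ∀ k,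
            (∑ i ∈ Finset.univ.filter (fun i : Fin m => (i : ℕ) < k), w (σ i)) / c ∈
              Set.Icc 0 ((∑ i, w i) / c) := by
      intro c hc hW
      rw [Finset.sum_div] at hW
      obtain ⟨ν, h1, h3⟩ := exists_isAlmostUniform_mem_Icc hc hW
      rw [hcard] at h1
      have h2 := h1.mono (b := 38400 * Real.exp 48 * (m : ℝ) ^ 2) (by nlinarith)
      refine ⟨_, h2.isRandomPerm, h2.isAlphaUniform, fun σ hσ k => ?_⟩
      have h4 := h3 _ (ofFn_mem_orderings σ) hσ k
      rwa [listWeight_div, listWeight_take_ofFn, ← Finset.sum_div] at h4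
    intro hW
    rcases lt_abs.1 hW with hW | hW
    · obtain ⟨μ, h1, h2, h3⟩ := key M hdiv (by rwa [lt_div_iff₀ hM0])
      refine ⟨μ, h1, h2, fun σ hσ k _ _ => ?_⟩
      have h4 := h3 σ hσ k
      rw [Set.mem_Icc, div_le_div_iff_of_pos_right hM0, le_div_iff₀ hM0, zero_mul] at h4
      rw [Nat.cast_zero, zero_mul, sub_zero, add_zero]
      exact ⟨(min_le_right _ _).trans h4.1, h4.2.trans (le_max_left _ _)⟩
    · obtain ⟨μ, h1, h2, h3⟩ := key (-M) (fun i hi => by rw [div_neg, abs_neg]; exact hdiv i hi)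
        (by rwa [div_neg, ← neg_div, lt_div_iff₀ hM0])
      refine ⟨μ, h1, h2, fun σ hσ k _ _ => ?_⟩
      have h4 := h3 σ hσ k
      rw [Set.mem_Icc, div_neg, div_neg, ← neg_div, ← neg_div, div_le_div_iff_of_pos_right hM0,
        le_div_iff₀ hM0, zero_mul, neg_le_neg_iff, neg_nonneg] at h4
      rw [Nat.cast_zero, zero_mul, sub_zero, add_zero]
      exact ⟨(min_le_left _ _).trans h4.2, h4.1.trans (le_max_right _ _)⟩
end

section
/- Let (Z_i)_{i≥0} be a sequence of real random variables adapted to a filtration (F_i)_{i≥0} on a probability space, with Z₀ = z₀ a constant, and let R, Δ, M > 0 with Δ < R be such that: (1) Z_i ≥ 0 almost surely for all i ≥ 0, and almost surely Z_i = 0 implies Z_{i+1} = 0; (2) |Z_i − Z_{i−1}| ≤ Δ almost surely for all i ≥ 1; (3) E[Z_i − Z_{i−1} | F_{i−1}] ≥ M almost surely on the event {0 < Z_{i−1} ≤ R}, for all i ≥ 1. Let T = min{i ≥ 0 : Z_i = 0}. Then for every t ≥ 0, Pr[T ≤ t] ≤ e^{−M·z₀/Δ²} + t·e^{−M·(R−Δ)/Δ²}.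 -/
open MeasureTheory

/-- The chord bound for `x ↦ exp (-(u * x))` on `[-1, 1]`. -/
theorem exp_neg_mul_le_cosh_sub_mul_sinh (u : ℝ) {x : ℝ} (hx : |x| ≤ 1) :
    Real.exp (-(u * x)) ≤ Real.cosh u - x * Real.sinh u := by
  obtain ⟨h1, h2⟩ := abs_le.1 hx
  have h := convexOn_exp.2 (Set.mem_univ u) (Set.mem_univ (-u))
    (show 0 ≤ (1 - x) / 2 by linarith) (show 0 ≤ (1 + x) / 2 by linarith) (by ring)
  simp only [smul_eq_mul] at h
  rw [Real.cosh_eq, Real.sinh_eq]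
  calc Real.exp (-(u * x)) = Real.exp ((1 - x) / 2 * u + (1 + x) / 2 * -u) := by ring_nf
    _ ≤ _ := h
    _ = _ := by ring

theorem cosh_sub_one_le_mul_sinh (u : ℝ) : Real.cosh u - 1 ≤ u * Real.sinh u := by
  have key (v : ℝ) : (1 - v) * Real.exp v ≤ 1 := by
    have h := mul_le_mul_of_nonneg_right (Real.one_sub_le_exp_neg v) (Real.exp_pos v).le
    rwa [← Real.exp_add, neg_add_cancel, Real.exp_zero] at h
  have h1 := key u
  have h2 := key (-u)
  rw [Real.cosh_eq, Real.sinh_eq]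
  linarith

theorem integrable_exp_neg_mul_div_sq
    {α : Type*} {m0 : MeasurableSpace α} {μ : Measure α} [IsFiniteMeasure μ] {V : α → ℝ} {M : ℝ}
    (hM : 0 ≤ M) (d : ℝ) (hV : Measurable V) (hV0 : ∀ᵐ ω ∂μ, 0 ≤ V ω) :
    Integrable (fun ω => Real.exp (-(M * V ω) / d ^ 2)) μ := by
  refine Integrable.of_bound (C := 1) (by fun_prop) ?_
  filter_upwards [hV0] with ω h
  rw [Real.norm_eq_abs, Real.abs_exp, Real.exp_le_one_iff, neg_div, neg_nonpos]
  positivity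

/-- One step of the exponential supermartingale estimate: if `Y` is obtained from `X` by a step
bounded by `d`, with conditional drift at least `M` when `0 < X ≤ R`, then
`E[exp (-(M * Y) / d ^ 2)]` exceeds `E[exp (-(M * X) / d ^ 2)]` by at most
`exp (-(M * (R - d)) / d ^ 2)`. -/
theorem integral_exp_neg_le_of_drift
    {α : Type*} {m m0 : MeasurableSpace α} (hm : m ≤ m0) (μ : Measure α) [IsProbabilityMeasure μ]
    {X Y : α → ℝ} (hX : Measurable[m] X) (hY : Measurable Y)
    {R d M : ℝ} (hd : 0 < d) (hM : 0 < M)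
    (hX0 : ∀ᵐ ω ∂μ, 0 ≤ X ω) (hY0 : ∀ᵐ ω ∂μ, 0 ≤ Y ω)
    (habsorb : ∀ᵐ ω ∂μ, X ω = 0 → Y ω = 0)
    (hbdd : ∀ᵐ ω ∂μ, |Y ω - X ω| ≤ d)
    (hdrift : ∀ᵐ ω ∂μ, (0 < X ω ∧ X ω ≤ R) → M ≤ (μ[(fun ω' => Y ω' - X ω') | m]) ω) :
    ∫ ω, Real.exp (-(M * Y ω) / d ^ 2) ∂μ ≤
      ∫ ω, Real.exp (-(M * X ω) / d ^ 2) ∂μ + Real.exp (-(M * (R - d)) / d ^ 2) := by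
  have hX' : Measurable X := hX.mono hm le_rfl
  set c := Real.exp (-(M * (R - d)) / d ^ 2)
  set u := M / d with hu
  set D : α → ℝ := fun ω => Y ω - X ω with hD
  set A : Set α := {ω | 0 < X ω ∧ X ω ≤ R} with hA
  set g : α → ℝ := A.indicator fun ω => Real.exp (-(M * X ω) / d ^ 2) with hg
  have hAm : MeasurableSet[m] A :=
    (measurableSet_lt measurable_const hX).inter (measurableSet_le hX measurable_const)
  have hgm : StronglyMeasurable[m] g := by
    refine Measurable.stronglyMeasurable (Measurable.indicator ?_ hAm)
    exact Real.measurable_exp.comp (((hX.const_mul M).neg).div_const _)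
  have hgi : Integrable g μ := (integrable_exp_neg_mul_div_sq hM.le d hX' hX0).indicator (hm _ hAm)
  have hg0 (ω : α) : 0 ≤ g ω := Set.indicator_nonneg (fun _ _ => (Real.exp_pos _).le) ω
  have hDi : Integrable D μ :=
    Integrable.of_bound (C := d) (hY.sub hX').aestronglyMeasurable hbdd
  have hgD : Integrable (fun ω => g ω * D ω) μ :=
    hgi.mul_bdd (c := d) hDi.aestronglyMeasurable hbdd
  have hdrift_int : M * ∫ ω, g ω ∂μ ≤ ∫ ω, g ω * D ω ∂μ := by
    have hpull : μ[fun ω => g ω * D ω | m] =ᵐ[μ] fun ω => g ω * (μ[D | m]) ω :=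
      condExp_mul_of_stronglyMeasurable_left hgm hgD hDi
    rw [← integral_condExp hm (f := fun ω => g ω * D ω), ← integral_const_mul]
    refine integral_mono_ae (hgi.const_mul M) integrable_condExp ?_
    filter_upwards [hpull, hdrift] with ω h1 h2
    rw [h1]
    by_cases hω : ω ∈ A
    · have := mul_le_mul_of_nonneg_left (h2 hω) (hg0 ω)
      linarith
    · simp [hg, Set.indicator_of_notMem hω]
  have hstep : ∀ᵐ ω ∂μ, Real.exp (-(M * Y ω) / d ^ 2) ≤
      Real.exp (-(M * X ω) / d ^ 2) + c +
        ((Real.cosh u - 1) * g ω - Real.sinh u / d * (g ω * D ω)) := by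
    filter_upwards [hX0, habsorb, hbdd] with ω h0 habs hb
    have hc : 0 < c := Real.exp_pos _
    by_cases hω : ω ∈ A
    · have hgω : g ω = Real.exp (-(M * X ω) / d ^ 2) := Set.indicator_of_mem hω _
      have hDd : |D ω / d| ≤ 1 := by
        rw [abs_div, abs_of_pos hd]
        exact (div_le_one hd).2 hb
      have hchord := mul_le_mul_of_nonneg_left (exp_neg_mul_le_cosh_sub_mul_sinh u hDd) (hg0 ω)
      have hsplit : Real.exp (-(M * Y ω) / d ^ 2) = g ω * Real.exp (-(u * (D ω / d))) := by
        rw [hgω, ← Real.exp_add]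
        congr 1
        simp only [hu, hD]
        field_simp
        ring
      rw [hsplit, ← hgω]
      calc _ ≤ _ := hchord
        _ = g ω + ((Real.cosh u - 1) * g ω - Real.sinh u / d * (g ω * D ω)) := by ring
        _ ≤ _ := by linarith
    · have hgω : g ω = 0 := Set.indicator_of_notMem hω _
      simp only [hgω, mul_zero, zero_mul, sub_zero, add_zero]
      rcases h0.eq_or_lt with hz | hz
      · rw [habs hz.symm, ← hz]
        linarith
      · have hR : R < X ω := not_le.1 fun h => hω ⟨hz, h⟩
        have hYc : Real.exp (-(M * Y ω) / d ^ 2) ≤ c := by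
          have := (abs_le.1 hb).1
          refine Real.exp_le_exp.2 ?_
          gcongr
          linarith
        linarith [Real.exp_pos (-(M * X ω) / d ^ 2)]
  have hXi := integrable_exp_neg_mul_div_sq hM.le d hX' hX0
  have h1 : Integrable (fun ω => Real.exp (-(M * X ω) / d ^ 2) + c) μ :=
    hXi.add (integrable_const c)
  have h2 := hgi.const_mul (Real.cosh u - 1)
  have h3 := hgD.const_mul (Real.sinh u / d)
  have hint := integral_mono_ae (integrable_exp_neg_mul_div_sq hM.le d hY hY0)
    (h1.add (h2.sub h3)) hstep
  rw [integral_add' h1 (h2.sub h3), integral_add hXi (integrable_const c),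
    integral_sub' h2 h3, integral_const_mul, integral_const_mul] at hint
  simp only [integral_const, probReal_univ, one_smul] at hint
  have hsinh : 0 ≤ Real.sinh u / d := by
    have : 0 ≤ Real.sinh u := Real.sinh_nonneg_iff.2 (by positivity)
    positivity
  have h4 := mul_le_mul_of_nonneg_left hdrift_int hsinh
  have h5 := mul_le_mul_of_nonneg_right (cosh_sub_one_le_mul_sinh u)
    (integral_nonneg (μ := μ) hg0)
  have h6 : Real.sinh u / d * (M * ∫ ω, g ω ∂μ) = u * Real.sinh u * ∫ ω, g ω ∂μ := by
    rw [hu]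
    ring
  linarith

/-- A submartingale-type hitting time bound: if `(Z_i)` is adapted,
nonnegative, absorbs at `0`, has increments bounded by `d`, and drifts upwards by at
least `M` in conditional expectation whenever `0 < Z_{i-1} ≤ R`, then the hitting
time `T` of `0` satisfies `Pr[T ≤ t] ≤ e^{-M z₀ / d²} + t e^{-M (R - d) / d²}`. -/
theorem submartingale_hitting_time_bound
    {α : Type*} {m0 : MeasurableSpace α} (μ : Measure α) [IsProbabilityMeasure μ]
    (𝒢 : Filtration ℕ m0) (Z : ℕ → α → ℝ) (hadapt : Adapted 𝒢 Z)
    (z₀ R d M : ℝ) (hR : 0 < R) (hd : 0 < d) (hM : 0 < M) (hdR : d < R)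
    (hZ0 : ∀ ω, Z 0 ω = z₀)
    (hpos : ∀ i, ∀ᵐ ω ∂μ, 0 ≤ Z i ω)
    (habsorb : ∀ i, ∀ᵐ ω ∂μ, Z i ω = 0 → Z (i + 1) ω = 0)
    (hbdd : ∀ i, 1 ≤ i → ∀ᵐ ω ∂μ, |Z i ω - Z (i - 1) ω| ≤ d)
    (hdrift : ∀ i, 1 ≤ i → ∀ᵐ ω ∂μ,
      (0 < Z (i - 1) ω ∧ Z (i - 1) ω ≤ R) →
        M ≤ (μ[(fun ω' => Z i ω' - Z (i - 1) ω') | 𝒢 (i - 1)]) ω)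
    (t : ℕ) :
    (μ {ω | ∃ i ≤ t, Z i ω = 0}).toReal ≤
      Real.exp (-(M * z₀) / d ^ 2) + t * Real.exp (-(M * (R - d)) / d ^ 2) := by
  have hmeas (i : ℕ) : Measurable (Z i) := (hadapt i).mono (𝒢.le i) le_rfl
  have hexp (n : ℕ) : ∫ ω, Real.exp (-(M * Z n ω) / d ^ 2) ∂μ ≤
      Real.exp (-(M * z₀) / d ^ 2) + n * Real.exp (-(M * (R - d)) / d ^ 2) := by
    induction n with
    | zero => simp [hZ0]
    | succ n ih =>
      have h := integral_exp_neg_le_of_drift (𝒢.le n) μ (hadapt n) (hmeas (n + 1)) hd hM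
        (hpos n) (hpos (n + 1)) (habsorb n) (hbdd (n + 1) (by omega)) (hdrift (n + 1) (by omega))
      push_cast
      linarith
  have hhit : ∀ᵐ ω ∂μ, (∃ i ≤ t, Z i ω = 0) → Z t ω = 0 := by
    filter_upwards [ae_all_iff.2 habsorb] with ω h
    rintro ⟨i, hi, h0⟩
    exact Nat.le_induction h0 (fun n _ => h n) t hi
  have hset : MeasurableSet {ω | Z t ω = 0} := hmeas t (measurableSet_singleton 0)
  calc (μ {ω | ∃ i ≤ t, Z i ω = 0}).toReal
      ≤ (μ {ω | Z t ω = 0}).toReal :=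
        ENNReal.toReal_mono (measure_ne_top _ _) (measure_mono_ae hhit)
    _ = ∫ ω, {ω | Z t ω = 0}.indicator (fun _ => (1 : ℝ)) ω ∂μ := by
        rw [integral_indicator_const _ hset, smul_eq_mul, mul_one, measureReal_def]
    _ ≤ ∫ ω, Real.exp (-(M * Z t ω) / d ^ 2) ∂μ := by
        refine integral_mono ((integrable_const 1).indicator hset)
          (integrable_exp_neg_mul_div_sq hM.le d (hmeas t) (hpos t)) fun ω => ?_
        by_cases h : Z t ω = 0
        · simp [h]
        · simpa [h] using (Real.exp_pos _).le
    _ ≤ _ := hexp t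
end
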